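/- arXiv:1312.0308 — 2 statements merged into one kernel-verified Lean document; each statement's English description precedes it below -/
import Mathlib

section
/- (Uniform confidence band, coverage.) Under the stated assumptions, for every α ∈ (0,1) there exist a constant C > 0 and N₀ such that for all n ≥ N₀, Pⁿ( for all t ∈ [t₁,t₂]: λ̄_n(t) − Z̃_α(λ_1,…,λ_n)/√n ≤ μ(t) ≤ λ̄_n(t) + Z̃_α(λ_1,…,λ_n)/√n ) ≥ 1 − α − C (log n)^{7/8} n^{−1/8}. -/
open MeasureTheory ProbabilityTheory Set Filter

noncomputable section

/-- A landscape-type function for `T`: 1-Lipschitz, with values in `[0, T/2]`,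
and vanishing outside `[0, T]`. -/
def IsLandscapeType (T : ℝ) (f : ℝ → ℝ) : Prop :=
  LipschitzWith 1 f ∧ (∀ t, 0 ≤ f t ∧ f t ≤ T / 2) ∧ ∀ t ∉ Set.Icc (0 : ℝ) T, f t = 0

/-- The Borel σ-algebra on the space `C(ℝ, ℝ)` of continuous functions with the
topology of uniform convergence on compact sets (the compact-open topology). -/
instance : MeasurableSpace C(ℝ, ℝ) := borel _

instance : BorelSpace C(ℝ, ℝ) := ⟨rfl⟩

/-- The mean function `μ(t) = ∫ λ(t) dP(λ)`. -/
def lmean (P : Measure C(ℝ, ℝ)) (t : ℝ) : ℝ := ∫ f, f t ∂P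

/-- The variance function `σ(t)² = ∫ λ(t)² dP(λ) − μ(t)²`. -/
def lvar (P : Measure C(ℝ, ℝ)) (t : ℝ) : ℝ := (∫ f, (f t) ^ 2 ∂P) - (lmean P t) ^ 2

/-- The standard deviation function `σ(t)`. -/
def lsd (P : Measure C(ℝ, ℝ)) (t : ℝ) : ℝ := Real.sqrt (lvar P t)

/-- The empirical average `λ̄_n(t) = (1/n) Σ_i λ_i(t)` of a tuple of functions. -/
def empMean (n : ℕ) (l : Fin n → C(ℝ, ℝ)) (t : ℝ) : ℝ := (∑ i, l i t) / n

/-- The empirical standard deviation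
`σ̂_n(t) = sqrt((1/n) Σ_i λ_i(t)² − λ̄_n(t)²)` of a tuple of functions. -/
def empSD (n : ℕ) (l : Fin n → C(ℝ, ℝ)) (t : ℝ) : ℝ :=
  Real.sqrt ((∑ i, (l i t) ^ 2) / n - (empMean n l t) ^ 2)

/-- The multiplier bootstrap quantile `Z̃_α(l)`: the infimum of all `z` such that
`P_ξ(sup_{t ∈ [t₁,t₂]} |n^{−1/2} Σ_i ξ_i (l_i(t) − l̄_n(t))| > z) ≤ α`, the probability
taken over i.i.d. standard Gaussian multipliers `ξ = (ξ_1, …, ξ_n)` only. -/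
def bootQuant (t₁ t₂ α : ℝ) (n : ℕ) (l : Fin n → C(ℝ, ℝ)) : ℝ :=
  sInf {z : ℝ |
    (Measure.pi fun _ : Fin n => gaussianReal 0 1)
      {ξ | z < ⨆ t : Icc t₁ t₂, |(∑ i, ξ i * (l i ↑t - empMean n l ↑t)) / Real.sqrt n|}
      ≤ ENNReal.ofReal α}

/-! ### Lindeberg replacement -/

lemma integral_pi_succ_sum {Ω E : Type*} [MeasurableSpace Ω] [AddCommMonoid E]
    (κ : Measure Ω) [IsProbabilityMeasure κ] (φ : Ω → E) (G : E → ℝ) (k : ℕ)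
    (hint : Integrable (fun z : Ω × (Fin k → Ω) => G (φ z.1 + ∑ i, φ (z.2 i)))
      (κ.prod (Measure.pi fun _ : Fin k => κ))) :
    ∫ ω, G (∑ i, φ (ω i)) ∂(Measure.pi fun _ : Fin (k + 1) => κ)
      = ∫ x, ∫ ω, G (φ x + ∑ i, φ (ω i)) ∂(Measure.pi fun _ : Fin k => κ) ∂κ := by
  have hmp := measurePreserving_piFinSuccAbove (fun _ : Fin (k + 1) => κ) 0
  rw [← integral_prod _ hint, ← hmp.integral_comp']
  refine integral_congr_ae (Eventually.of_forall fun ω => ?_)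
  simp only [Fin.sum_univ_succ]
  rfl

lemma integrable_comp_of_abs_le_one {α E : Type*} [MeasurableSpace α] [MeasurableSpace E]
    (m : Measure α) [IsFiniteMeasure m] {g : E → ℝ} (hg : Measurable g) (hg1 : ∀ w, |g w| ≤ 1)
    {f : α → E} (hf : Measurable f) : Integrable (fun a => g (f a)) m :=
  Integrable.of_bound (hg.comp hf).aestronglyMeasurable 1
    (Eventually.of_forall fun a => by simpa using hg1 (f a))

lemma abs_integral_integral_sub_le {Ω Ω' A J : Type*} [MeasurableSpace Ω] [MeasurableSpace Ω']
    [MeasurableSpace A] [Fintype J] (κ : Measure Ω) [IsProbabilityMeasure κ] (κ' : Measure Ω')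
    [IsProbabilityMeasure κ'] (m : Measure A) [IsProbabilityMeasure m]
    {φ : Ω → J → ℝ} (hφ : Measurable φ) {φ' : Ω' → J → ℝ} (hφ' : Measurable φ')
    {s : A → J → ℝ} (hs : Measurable s)
    {g : (J → ℝ) → ℝ} (hg : Measurable g) (hg1 : ∀ w, |g w| ≤ 1) {η : ℝ}
    (h : ∀ y, |∫ ω, g (y + φ ω) ∂κ - ∫ ω, g (y + φ' ω) ∂κ'| ≤ η) (y : J → ℝ) :
    |∫ x, ∫ a, g (y + (φ x + s a)) ∂m ∂κ - ∫ x, ∫ a, g (y + (φ' x + s a)) ∂m ∂κ'| ≤ η := by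
  have i3 : Integrable (fun z : Ω × A => g (y + (φ z.1 + s z.2))) (κ.prod m) :=
    integrable_comp_of_abs_le_one _ hg hg1 (by fun_prop)
  have i2 : Integrable (fun z : Ω' × A => g (y + (φ' z.1 + s z.2))) (κ'.prod m) :=
    integrable_comp_of_abs_le_one _ hg hg1 (by fun_prop)
  rw [integral_integral_swap (f := fun x a => g (y + (φ x + s a))) i3,
    integral_integral_swap (f := fun x a => g (y + (φ' x + s a))) i2,
    ← integral_sub i3.integral_prod_right i2.integral_prod_right]
  have := norm_integral_le_of_norm_le_const (μ := m) (C := η)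
    (f := fun a => ∫ x, g (y + (φ x + s a)) ∂κ - ∫ x, g (y + (φ' x + s a)) ∂κ')
    (Eventually.of_forall fun a => by
      simpa only [Real.norm_eq_abs, add_assoc, add_comm (s a)] using h (y + s a))
  simpa using this

/-- Replacing one summand at a time: if exchanging one increment changes the integral of every
translate of `g` by at most `η`, then exchanging `k` independent increments changes it by at most
`k * η`. -/
lemma abs_integral_sum_sub_le {Ω Ω' J : Type*} [MeasurableSpace Ω] [MeasurableSpace Ω'] [Fintype J]
    (κ : Measure Ω) [IsProbabilityMeasure κ] (κ' : Measure Ω') [IsProbabilityMeasure κ']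
    {φ : Ω → J → ℝ} (hφ : Measurable φ) {φ' : Ω' → J → ℝ} (hφ' : Measurable φ')
    {g : (J → ℝ) → ℝ} (hg : Measurable g) (hg1 : ∀ w, |g w| ≤ 1) {η : ℝ}
    (h : ∀ y, |∫ ω, g (y + φ ω) ∂κ - ∫ ω, g (y + φ' ω) ∂κ'| ≤ η) (k : ℕ) (y : J → ℝ) :
    |∫ ω, g (y + ∑ i, φ (ω i)) ∂(Measure.pi fun _ : Fin k => κ)
      - ∫ ω, g (y + ∑ i, φ' (ω i)) ∂(Measure.pi fun _ : Fin k => κ')| ≤ k * η := by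
  induction k generalizing y with
  | zero => simp
  | succ k ih =>
    set Q := Measure.pi fun _ : Fin k => κ with hQ
    set Q' := Measure.pi fun _ : Fin k => κ' with hQ'
    have i1 : Integrable (fun z : Ω × (Fin k → Ω) => g (y + (φ z.1 + ∑ i, φ (z.2 i))))
        (κ.prod Q) :=
      integrable_comp_of_abs_le_one _ hg hg1 (by fun_prop)
    have i2 : Integrable (fun z : Ω' × (Fin k → Ω') => g (y + (φ' z.1 + ∑ i, φ' (z.2 i))))
        (κ'.prod Q') :=
      integrable_comp_of_abs_le_one _ hg hg1 (by fun_prop)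
    have i3 : Integrable (fun z : Ω × (Fin k → Ω') => g (y + (φ z.1 + ∑ i, φ' (z.2 i))))
        (κ.prod Q') :=
      integrable_comp_of_abs_le_one _ hg hg1 (by fun_prop)
    rw [integral_pi_succ_sum κ φ (fun w => g (y + w)) k i1,
      integral_pi_succ_sum κ' φ' (fun w => g (y + w)) k i2]
    have e1 : |∫ x, ∫ ω, g (y + (φ x + ∑ i, φ (ω i))) ∂Q ∂κ
        - ∫ x, ∫ ω, g (y + (φ x + ∑ i, φ' (ω i))) ∂Q' ∂κ| ≤ k * η := by
      rw [← integral_sub i1.integral_prod_left i3.integral_prod_left]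
      have := norm_integral_le_of_norm_le_const (μ := κ) (C := k * η)
        (f := fun x => ∫ ω, g (y + (φ x + ∑ i, φ (ω i))) ∂Q
          - ∫ ω, g (y + (φ x + ∑ i, φ' (ω i))) ∂Q')
        (Eventually.of_forall fun x => by simpa [add_assoc] using ih (y + φ x))
      simpa using this
    have e2 : |∫ x, ∫ ω, g (y + (φ x + ∑ i, φ' (ω i))) ∂Q' ∂κ
        - ∫ x, ∫ ω, g (y + (φ' x + ∑ i, φ' (ω i))) ∂Q' ∂κ'| ≤ η := by
      exact abs_integral_integral_sub_le κ κ' Q' hφ hφ' (by fun_prop) hg hg1 h y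
    push_cast
    have := abs_sub_le (∫ x, ∫ ω, g (y + (φ x + ∑ i, φ (ω i))) ∂Q ∂κ)
      (∫ x, ∫ ω, g (y + (φ x + ∑ i, φ' (ω i))) ∂Q' ∂κ)
      (∫ x, ∫ ω, g (y + (φ' x + ∑ i, φ' (ω i))) ∂Q' ∂κ')
    linarith

/-- `g` has at every point a second-order Taylor expansion whose quadratic coefficients have
absolute sum at most `D₂` and whose remainder is at most `D₃ ‖x‖³`. -/
def HasTaylorBound {J : Type*} [Fintype J] (g : (J → ℝ) → ℝ) (D₂ D₃ : ℝ) : Prop :=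
  ∀ y : J → ℝ, ∃ (c : J → ℝ) (q : J → J → ℝ), ∑ j, ∑ k, |q j k| ≤ D₂ ∧
    ∀ x : J → ℝ, |g (y + x) - g y - ∑ j, c j * x j - ∑ j, ∑ k, q j k * (x j * x k)|
      ≤ D₃ * ‖x‖ ^ 3

lemma integrable_coord_of_norm_pow_three {Ω J : Type*} [MeasurableSpace Ω] [Fintype J]
    (κ : Measure Ω) [IsProbabilityMeasure κ] {φ : Ω → J → ℝ} (hφ : Measurable φ)
    (h3 : Integrable (fun ω => ‖φ ω‖ ^ 3) κ) (j k : J) :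
    Integrable (fun ω => φ ω j) κ ∧ Integrable (fun ω => φ ω j * φ ω k) κ := by
  have hj : ∀ j, Measurable fun ω => φ ω j := fun j => (measurable_pi_apply j).comp hφ
  have hb : Integrable (fun ω => 1 + ‖φ ω‖ ^ 3) κ := (integrable_const 1).add h3
  refine ⟨hb.mono' (hj j).aestronglyMeasurable (Eventually.of_forall fun ω => ?_),
    hb.mono' ((hj j).mul (hj k)).aestronglyMeasurable (Eventually.of_forall fun ω => ?_)⟩
  · have h1 := norm_le_pi_norm (φ ω) j
    have h0 := norm_nonneg (φ ω)
    nlinarith [sq_nonneg (‖φ ω‖ - 1), mul_nonneg h0 (sq_nonneg (‖φ ω‖ - 1))]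
  · have h1 := norm_le_pi_norm (φ ω) j
    have h2 := norm_le_pi_norm (φ ω) k
    have h0 := norm_nonneg (φ ω)
    rw [norm_mul]
    have := mul_le_mul h1 h2 (norm_nonneg _) h0
    nlinarith [mul_nonneg h0 (sq_nonneg (‖φ ω‖ - 1)), sq_nonneg (‖φ ω‖ - 1)]

lemma abs_integral_sub_taylor_le {α J : Type*} [MeasurableSpace α] [Fintype J]
    (m : Measure α) [IsProbabilityMeasure m] {f : α → J → ℝ} (hf : Measurable f)
    {g : (J → ℝ) → ℝ} (hg : Measurable g) (hg1 : ∀ w, |g w| ≤ 1) {D₃ : ℝ} {y c : J → ℝ}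
    {q : J → J → ℝ}
    (hR : ∀ x : J → ℝ, |g (y + x) - g y - ∑ j, c j * x j - ∑ j, ∑ k, q j k * (x j * x k)|
      ≤ D₃ * ‖x‖ ^ 3)
    (hf3 : Integrable (fun a => ‖f a‖ ^ 3) m) :
    |∫ a, g (y + f a) ∂m - (g y + ∑ j, c j * ∫ a, f a j ∂m
        + ∑ j, ∑ k, q j k * ∫ a, f a j * f a k ∂m)| ≤ D₃ * ∫ a, ‖f a‖ ^ 3 ∂m := by
  have hi := fun j k => integrable_coord_of_norm_pow_three m hf hf3 j k
  have hgi : Integrable (fun a => g (y + f a)) m :=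
    integrable_comp_of_abs_le_one m hg hg1 (measurable_const.add hf)
  have I0 : Integrable (fun a => g (y + f a) - g y) m := hgi.sub (integrable_const _)
  have I1 : Integrable (fun a => ∑ j, c j * f a j) m :=
    integrable_finsetSum _ fun j _ => (hi j j).1.const_mul _
  have I2 : Integrable (fun a => ∑ j, ∑ k, q j k * (f a j * f a k)) m :=
    integrable_finsetSum _ fun j _ => integrable_finsetSum _ fun k _ => (hi j k).2.const_mul _
  have I3 : Integrable (fun a => g (y + f a) - g y - ∑ j, c j * f a j) m := I0.sub I1
  have e : ∫ a, (g (y + f a) - g y - ∑ j, c j * f a j - ∑ j, ∑ k, q j k * (f a j * f a k)) ∂m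
      = ∫ a, g (y + f a) ∂m - (g y + ∑ j, c j * ∫ a, f a j ∂m
        + ∑ j, ∑ k, q j k * ∫ a, f a j * f a k ∂m) := by
    rw [integral_sub I3 I2, integral_sub I0 I1, integral_sub hgi (integrable_const _),
      integral_finsetSum _ fun j _ => (hi j j).1.const_mul _,
      integral_finsetSum _ fun j _ => integrable_finsetSum _ fun k _ => (hi j k).2.const_mul _]
    simp_rw [integral_finsetSum _ fun k _ => (hi _ k).2.const_mul _, integral_const_mul]
    simp
    ring
  rw [← e, ← integral_const_mul]
  exact abs_integral_le_integral_abs.trans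
    (integral_mono (I3.sub I2).abs (hf3.const_mul _) fun a => hR (f a))

/-- One replacement step, by Taylor expansion. -/
lemma abs_integral_sub_le_of_taylor {Ω Ω' J : Type*} [MeasurableSpace Ω] [MeasurableSpace Ω']
    [Fintype J] (κ : Measure Ω) [IsProbabilityMeasure κ] (κ' : Measure Ω') [IsProbabilityMeasure κ']
    {φ : Ω → J → ℝ} (hφ : Measurable φ) {φ' : Ω' → J → ℝ} (hφ' : Measurable φ')
    {g : (J → ℝ) → ℝ} (hg : Measurable g) (hg1 : ∀ w, |g w| ≤ 1) {D₂ D₃ Δ : ℝ}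
    (hΔ : 0 ≤ Δ) (hT : HasTaylorBound g D₂ D₃)
    (h3 : Integrable (fun ω => ‖φ ω‖ ^ 3) κ) (h3' : Integrable (fun ω => ‖φ' ω‖ ^ 3) κ')
    (hm : ∀ j, ∫ ω, φ ω j ∂κ = ∫ ω, φ' ω j ∂κ')
    (hv : ∀ j k, |∫ ω, φ ω j * φ ω k ∂κ - ∫ ω, φ' ω j * φ' ω k ∂κ'| ≤ Δ) (y : J → ℝ) :
    |∫ ω, g (y + φ ω) ∂κ - ∫ ω, g (y + φ' ω) ∂κ'|
      ≤ D₂ * Δ + D₃ * (∫ ω, ‖φ ω‖ ^ 3 ∂κ + ∫ ω, ‖φ' ω‖ ^ 3 ∂κ') := by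
  obtain ⟨c, q, hq, hR⟩ := hT y
  have k1 := abs_integral_sub_taylor_le κ hφ hg hg1 hR h3
  have k2 := abs_integral_sub_taylor_le κ' hφ' hg hg1 hR h3'
  have hdiff : |∑ j, ∑ k, q j k * ∫ ω, φ ω j * φ ω k ∂κ
      - ∑ j, ∑ k, q j k * ∫ ω, φ' ω j * φ' ω k ∂κ'| ≤ D₂ * Δ := by
    rw [← Finset.sum_sub_distrib]
    simp_rw [← Finset.sum_sub_distrib, ← mul_sub]
    calc _ ≤ ∑ j, ∑ k, |q j k| * Δ := by
          refine (Finset.abs_sum_le_sum_abs _ _).trans (Finset.sum_le_sum fun j _ => ?_)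
          refine (Finset.abs_sum_le_sum_abs _ _).trans (Finset.sum_le_sum fun k _ => ?_)
          rw [abs_mul]
          exact mul_le_mul_of_nonneg_left (hv j k) (abs_nonneg _)
      _ = (∑ j, ∑ k, |q j k|) * Δ := by simp_rw [Finset.sum_mul]
      _ ≤ D₂ * Δ := by
          exact mul_le_mul_of_nonneg_right hq hΔ
  simp_rw [hm] at k1
  rw [abs_le] at *
  constructor <;> linarith [k1.1, k1.2, k2.1, k2.2, hdiff.1, hdiff.2]

/-! ### A smooth approximation of the indicator of a large maximum -/

lemma abs_sub_taylor_two_le {f f₁ f₂ f₃ : ℝ → ℝ} (h₁ : ∀ s, HasDerivAt f (f₁ s) s)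
    (h₂ : ∀ s, HasDerivAt f₁ (f₂ s) s) (h₃ : ∀ s, HasDerivAt f₂ (f₃ s) s) {C : ℝ}
    (hC : ∀ s, |f₃ s| ≤ C) : |f 1 - f 0 - f₁ 0 - f₂ 0 / 2| ≤ C := by
  have hC0 : 0 ≤ C := (abs_nonneg _).trans (hC 0)
  have mvt : ∀ (F F' : ℝ → ℝ), (∀ s, HasDerivAt F (F' s) s) → (∀ s ∈ Icc (0 : ℝ) 1, |F' s| ≤ C) →
      ∀ s ∈ Icc (0 : ℝ) 1, |F s - F 0| ≤ C := by
    intro F F' hF hF' s hs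
    have := norm_image_sub_le_of_norm_deriv_le_segment' (f := F) (f' := F') (a := 0) (b := 1)
      (C := C) (fun u _ => (hF u).hasDerivWithinAt)
      (fun u hu => hF' u ⟨hu.1, hu.2.le⟩) s hs
    rw [Real.norm_eq_abs] at this
    nlinarith [hs.1, hs.2]
  have a2 := mvt f₂ f₃ h₃ fun s _ => hC s
  have a1 := mvt (fun s => f₁ s - s * f₂ 0) (fun s => f₂ s - f₂ 0)
    (fun s => ((h₂ s).sub ((hasDerivAt_id s).mul_const (f₂ 0))).congr_deriv (by simp)) a2
  have a0 := mvt (fun s => f s - s * f₁ 0 - s ^ 2 * (f₂ 0 / 2))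
    (fun s => f₁ s - f₁ 0 - s * f₂ 0)
    (fun s => by
      have := ((h₁ s).sub ((hasDerivAt_id s).mul_const (f₁ 0))).sub
        ((hasDerivAt_pow 2 s).mul_const (f₂ 0 / 2))
      refine this.congr_deriv ?_
      simp
      ring)
    (fun s hs => by simpa [sub_right_comm] using a1 s hs) 1 (by simp)
  simpa [sub_right_comm] using a0

lemma exists_bound_iteratedDeriv_smoothTransition :
    ∃ K : ℝ, 0 < K ∧ ∀ k ∈ ({1, 2, 3} : Finset ℕ), ∀ v,
      |iteratedDeriv k Real.smoothTransition v| ≤ K := by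
  have key : ∀ k : ℕ, 1 ≤ k → ∃ K : ℝ, ∀ v, |iteratedDeriv k Real.smoothTransition v| ≤ K := by
    intro k hk
    have hcont : Continuous (iteratedDeriv k Real.smoothTransition) :=
      (Real.smoothTransition.contDiff (n := ⊤)).continuous_iteratedDeriv k (by exact_mod_cast le_top)
    obtain ⟨K, hK⟩ := isCompact_Icc.exists_bound_of_continuousOn
      (s := Icc (0 : ℝ) 1) hcont.continuousOn
    have hzero : ∀ (v a : ℝ), Real.smoothTransition =ᶠ[nhds v] (fun _ => a) →
        iteratedDeriv k Real.smoothTransition v = 0 := by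
      intro v a h
      rw [h.iteratedDeriv_eq k, iteratedDeriv_const, if_neg (by omega)]
    refine ⟨K, fun v => ?_⟩
    have hK0 : 0 ≤ K := (norm_nonneg _).trans (hK 0 (by simp))
    rcases lt_or_ge v 0 with hv | hv
    · rw [hzero v 0, abs_zero]
      · exact hK0
      · filter_upwards [Iio_mem_nhds hv] with u hu
        exact Real.smoothTransition.zero_of_nonpos (le_of_lt hu)
    rcases lt_or_ge 1 v with hv' | hv'
    · rw [hzero v 1, abs_zero]
      · exact hK0
      · filter_upwards [Ioi_mem_nhds hv'] with u hu
        exact Real.smoothTransition.one_of_one_le (le_of_lt hu)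
    exact hK v ⟨hv, hv'⟩
  obtain ⟨K₁, h₁⟩ := key 1 le_rfl
  obtain ⟨K₂, h₂⟩ := key 2 (by norm_num)
  obtain ⟨K₃, h₃⟩ := key 3 (by norm_num)
  refine ⟨max 1 (max K₁ (max K₂ K₃)), by positivity, fun k hk v => ?_⟩
  simp only [Finset.mem_insert, Finset.mem_singleton] at hk
  rcases hk with rfl | rfl | rfl
  · exact (h₁ v).trans (by simp)
  · exact (h₂ v).trans (by simp)
  · exact (h₃ v).trans (by simp)

/-- Exponentially weighted power sums along a line. -/
def expPowerSum {J : Type*} [Fintype J] (β : ℝ) (y x : J → ℝ) (k : ℕ) (s : ℝ) : ℝ :=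
  ∑ j, x j ^ k * Real.exp (β * (y j + s * x j))

lemma hasDerivAt_expPowerSum {J : Type*} [Fintype J] (β : ℝ) (y x : J → ℝ) (k : ℕ) (s : ℝ) :
    HasDerivAt (expPowerSum β y x k) (β * expPowerSum β y x (k + 1) s) s := by
  have h : ∀ j, HasDerivAt (fun s => x j ^ k * Real.exp (β * (y j + s * x j)))
      (β * (x j ^ (k + 1) * Real.exp (β * (y j + s * x j)))) s := by
    intro j
    have h1 : HasDerivAt (fun s : ℝ => β * (y j + s * x j)) (β * x j) s := by
      simpa using (((hasDerivAt_id s).mul_const (x j)).const_add (y j)).const_mul β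
    refine ((h1.exp).const_mul (x j ^ k)).congr_deriv ?_
    ring
  exact (HasDerivAt.fun_sum (u := Finset.univ) fun j _ => h j).congr_deriv
    (by simp [expPowerSum, Finset.mul_sum])

lemma expPowerSum_zero_pos {J : Type*} [Fintype J] [Nonempty J] (β : ℝ) (y x : J → ℝ) (s : ℝ) :
    0 < expPowerSum β y x 0 s := by
  simp only [expPowerSum, pow_zero, one_mul]
  exact Finset.sum_pos (fun j _ => Real.exp_pos _) Finset.univ_nonempty

lemma abs_expPowerSum_div_le {J : Type*} [Fintype J] [Nonempty J] (β : ℝ) (y x : J → ℝ) (k : ℕ)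
    (s : ℝ) : |expPowerSum β y x k s / expPowerSum β y x 0 s| ≤ ‖x‖ ^ k := by
  have hpos := expPowerSum_zero_pos β y x s
  rw [abs_div, abs_of_pos hpos, div_le_iff₀ hpos]
  simp only [expPowerSum, pow_zero, one_mul, Finset.mul_sum]
  refine (Finset.abs_sum_le_sum_abs _ _).trans (Finset.sum_le_sum fun j _ => ?_)
  rw [abs_mul, abs_pow, abs_of_pos (Real.exp_pos _)]
  gcongr
  exact norm_le_pi_norm x j

/-- A smooth maximum composed with a smooth step of width `δ`. -/
def smoothExceed {J : Type*} [Fintype J] (β δ x₀ : ℝ) (w : J → ℝ) : ℝ :=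
  Real.smoothTransition ((Real.log (∑ j, Real.exp (β * w j)) / β - x₀) / δ)

lemma smoothExceed_line {J : Type*} [Fintype J] (β δ x₀ : ℝ) (y x : J → ℝ) (s : ℝ) :
    smoothExceed β δ x₀ (y + s • x)
      = Real.smoothTransition ((Real.log (expPowerSum β y x 0 s) / β - x₀) / δ) := by
  simp [smoothExceed, expPowerSum]

lemma hasTaylorBound_smoothExceed {J : Type*} [Fintype J] [Nonempty J] {K : ℝ}
    (hK : ∀ k ∈ ({1, 2, 3} : Finset ℕ), ∀ v, |iteratedDeriv k Real.smoothTransition v| ≤ K)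
    {β δ : ℝ} (hβ : 0 < β) (hδ : 0 < δ) (x₀ : ℝ) :
    HasTaylorBound (smoothExceed (J := J) β δ x₀) (K / δ ^ 2 + 2 * β * K / δ)
      (K / δ ^ 3 + 6 * β * K / δ ^ 2 + 6 * β ^ 2 * K / δ) := by
  have hK1 := hK 1 (by simp)
  have hK2 := hK 2 (by simp)
  have hK3 := hK 3 (by simp)
  have hK0 : 0 ≤ K := (abs_nonneg _).trans (hK1 0)
  set ψ := Real.smoothTransition
  have dψ : ∀ k v, HasDerivAt (iteratedDeriv k ψ) (iteratedDeriv (k + 1) ψ v) v := by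
    intro k v
    rw [iteratedDeriv_succ]
    have : Differentiable ℝ (iteratedDeriv k ψ) :=
      (Real.smoothTransition.contDiff (n := ⊤)).differentiable_iteratedDeriv k
        (by exact_mod_cast (WithTop.coe_lt_top k))
    exact (this v).hasDerivAt
  intro y
  set π : J → ℝ := fun j => Real.exp (β * y j) / ∑ k, Real.exp (β * y k) with hπ
  have hZpos : 0 < ∑ k, Real.exp (β * y k) :=
    Finset.sum_pos (fun j _ => Real.exp_pos _) Finset.univ_nonempty
  have hπ0 : ∀ j, 0 ≤ π j := fun j => by positivity
  have hπ1 : ∑ j, π j = 1 := by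
    rw [hπ, ← Finset.sum_div, div_self hZpos.ne']
  set v₀ : ℝ := (Real.log (∑ j, Real.exp (β * y j)) / β - x₀) / δ with hv₀
  classical
  refine ⟨fun j => iteratedDeriv 1 ψ v₀ * π j / δ,
    fun j k => ((iteratedDeriv 2 ψ v₀ / δ ^ 2 - iteratedDeriv 1 ψ v₀ * β / δ) * (π j * π k)
      + (if j = k then iteratedDeriv 1 ψ v₀ * β / δ * π j else 0)) / 2, ?_, fun x => ?_⟩
  · have hb : ∀ j k, |((iteratedDeriv 2 ψ v₀ / δ ^ 2 - iteratedDeriv 1 ψ v₀ * β / δ) * (π j * π k)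
        + (if j = k then iteratedDeriv 1 ψ v₀ * β / δ * π j else 0)) / 2|
        ≤ (K / δ ^ 2 + K * β / δ) * (π j * π k) + (if j = k then K * β / δ * π j else 0) := by
      intro j k
      have b1 : |iteratedDeriv 2 ψ v₀ / δ ^ 2| ≤ K / δ ^ 2 := by
        rw [abs_div, abs_of_pos (pow_pos hδ 2)]
        gcongr
        exact hK2 v₀
      have b2 : |iteratedDeriv 1 ψ v₀ * β / δ| ≤ K * β / δ := by
        rw [abs_div, abs_mul, abs_of_pos hβ, abs_of_pos hδ]
        gcongr
        exact hK1 v₀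
      have b3 : |(iteratedDeriv 2 ψ v₀ / δ ^ 2 - iteratedDeriv 1 ψ v₀ * β / δ) * (π j * π k)|
          ≤ (K / δ ^ 2 + K * β / δ) * (π j * π k) := by
        rw [abs_mul, abs_of_nonneg (mul_nonneg (hπ0 j) (hπ0 k))]
        refine mul_le_mul_of_nonneg_right ?_ (mul_nonneg (hπ0 j) (hπ0 k))
        exact (abs_sub _ _).trans (add_le_add b1 b2)
      have b4 : |if j = k then iteratedDeriv 1 ψ v₀ * β / δ * π j else 0|
          ≤ if j = k then K * β / δ * π j else 0 := by
        split_ifs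
        · rw [abs_mul, abs_of_nonneg (hπ0 j)]
          exact mul_le_mul_of_nonneg_right b2 (hπ0 j)
        · simp
      rw [abs_div, abs_two]
      have := (abs_add_le ((iteratedDeriv 2 ψ v₀ / δ ^ 2 - iteratedDeriv 1 ψ v₀ * β / δ)
        * (π j * π k)) (if j = k then iteratedDeriv 1 ψ v₀ * β / δ * π j else 0)).trans
        (add_le_add b3 b4)
      have h0 := abs_nonneg ((iteratedDeriv 2 ψ v₀ / δ ^ 2 - iteratedDeriv 1 ψ v₀ * β / δ)
        * (π j * π k) + (if j = k then iteratedDeriv 1 ψ v₀ * β / δ * π j else 0))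
      linarith
    refine (Finset.sum_le_sum fun j _ => Finset.sum_le_sum fun k _ => hb j k).trans (le_of_eq ?_)
    simp only [Finset.sum_add_distrib, Finset.sum_ite_eq, Finset.mem_univ, if_true,
      ← Finset.mul_sum, hπ1, mul_one]
    ring
  · set Z := expPowerSum β y x with hZ
    have hZ0 : ∀ s, 0 < Z 0 s := expPowerSum_zero_pos β y x
    set R := ‖x‖
    have hR : 0 ≤ R := norm_nonneg x
    set r : ℕ → ℝ → ℝ := fun k s => Z k s / Z 0 s with hr
    have hrb : ∀ k s, |r k s| ≤ R ^ k := abs_expPowerSum_div_le β y x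
    have dr : ∀ k s, HasDerivAt (r k) (β * (r (k + 1) s - r k s * r 1 s)) s := by
      intro k s
      refine ((hasDerivAt_expPowerSum β y x k s).div (hasDerivAt_expPowerSum β y x 0 s)
        (hZ0 s).ne').congr_deriv ?_
      have := (hZ0 s).ne'
      simp only [hr, hZ] at *
      field_simp
    have dr1 : ∀ s, HasDerivAt (r 1) (β * (r 2 s - r 1 s * r 1 s)) s := dr 1
    have dr2 : ∀ s, HasDerivAt (fun s => β * (r 2 s - r 1 s * r 1 s))
        (β ^ 2 * (r 3 s - 3 * r 2 s * r 1 s + 2 * r 1 s ^ 3)) s := by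
      intro s
      refine (((dr 2 s).sub ((dr 1 s).mul (dr 1 s))).const_mul β).congr_deriv ?_
      ring
    set v : ℝ → ℝ := fun s => (Real.log (Z 0 s) / β - x₀) / δ with hv
    have dv : ∀ s, HasDerivAt v (r 1 s / δ) s := by
      intro s
      refine (((((hasDerivAt_expPowerSum β y x 0 s).log (hZ0 s).ne').div_const β).sub_const
        x₀).div_const δ).congr_deriv ?_
      simp only [hr, hZ]
      field_simp
    have f1 : ∀ s, HasDerivAt (fun s => ψ (v s)) (iteratedDeriv 1 ψ (v s) * (r 1 s / δ)) s := by
      intro s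
      have := (dψ 0 (v s)).comp s (dv s)
      simpa [iteratedDeriv_zero, Function.comp_def] using this
    have f2 : ∀ s, HasDerivAt (fun s => iteratedDeriv 1 ψ (v s) * (r 1 s / δ))
        (iteratedDeriv 2 ψ (v s) * (r 1 s / δ) ^ 2
          + iteratedDeriv 1 ψ (v s) * (β * (r 2 s - r 1 s * r 1 s) / δ)) s := by
      intro s
      refine (((dψ 1 (v s)).comp s (dv s)).mul ((dr1 s).div_const δ)).congr_deriv ?_
      simp only [Function.comp_def]
      ring
    have f3 : ∀ s, HasDerivAt (fun s => iteratedDeriv 2 ψ (v s) * (r 1 s / δ) ^ 2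
          + iteratedDeriv 1 ψ (v s) * (β * (r 2 s - r 1 s * r 1 s) / δ))
        (iteratedDeriv 3 ψ (v s) * (r 1 s / δ) ^ 3
          + iteratedDeriv 2 ψ (v s) * (3 * β * (r 1 s * (r 2 s - r 1 s * r 1 s)) / δ ^ 2)
          + iteratedDeriv 1 ψ (v s)
            * (β ^ 2 * (r 3 s - 3 * r 2 s * r 1 s + 2 * r 1 s ^ 3) / δ)) s := by
      intro s
      refine ((((dψ 2 (v s)).comp s (dv s)).mul (((dr1 s).div_const δ).pow 2)).add
        (((dψ 1 (v s)).comp s (dv s)).mul ((dr2 s).div_const δ))).congr_deriv ?_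
      simp only [Function.comp_def, Pi.pow_apply]
      push_cast
      ring
    have bound : ∀ s, |iteratedDeriv 3 ψ (v s) * (r 1 s / δ) ^ 3
          + iteratedDeriv 2 ψ (v s) * (3 * β * (r 1 s * (r 2 s - r 1 s * r 1 s)) / δ ^ 2)
          + iteratedDeriv 1 ψ (v s)
            * (β ^ 2 * (r 3 s - 3 * r 2 s * r 1 s + 2 * r 1 s ^ 3) / δ)|
        ≤ (K / δ ^ 3 + 6 * β * K / δ ^ 2 + 6 * β ^ 2 * K / δ) * R ^ 3 := by
      intro s
      have h1 : |r 1 s| ≤ R := by simpa using hrb 1 s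
      have h2 := hrb 2 s
      have h3 := hrb 3 s
      have h11 : |r 1 s * r 1 s| ≤ R ^ 2 := by
        rw [abs_mul, sq]; exact mul_le_mul h1 h1 (abs_nonneg _) hR
      have c1 : |(r 1 s / δ) ^ 3| ≤ R ^ 3 / δ ^ 3 := by
        rw [div_pow, abs_div, abs_pow, abs_of_pos (pow_pos hδ 3)]
        gcongr
      have c2 : |3 * β * (r 1 s * (r 2 s - r 1 s * r 1 s)) / δ ^ 2|
          ≤ 6 * β * R ^ 3 / δ ^ 2 := by
        have : |r 1 s * (r 2 s - r 1 s * r 1 s)| ≤ R * (R ^ 2 + R ^ 2) := by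
          rw [abs_mul]
          exact mul_le_mul h1 ((abs_sub _ _).trans (add_le_add h2 h11)) (abs_nonneg _) hR
        rw [abs_div, abs_mul, abs_of_pos (pow_pos hδ 2), abs_of_pos (by positivity : 0 < 3 * β)]
        refine div_le_div_of_nonneg_right ?_ (by positivity)
        nlinarith
      have c3 : |β ^ 2 * (r 3 s - 3 * r 2 s * r 1 s + 2 * r 1 s ^ 3) / δ|
          ≤ 6 * β ^ 2 * R ^ 3 / δ := by
        have e1 : |3 * r 2 s * r 1 s| ≤ 3 * R ^ 3 := by
          rw [mul_assoc, abs_mul, abs_mul, abs_of_pos (by norm_num : (0 : ℝ) < 3)]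
          have := mul_le_mul h2 h1 (abs_nonneg _) (pow_nonneg hR 2)
          nlinarith
        have e2 : |2 * r 1 s ^ 3| ≤ 2 * R ^ 3 := by
          rw [abs_mul, abs_pow, abs_two]
          gcongr
        have : |r 3 s - 3 * r 2 s * r 1 s + 2 * r 1 s ^ 3| ≤ 6 * R ^ 3 := by
          have := abs_add_le (r 3 s - 3 * r 2 s * r 1 s) (2 * r 1 s ^ 3)
          have := abs_sub (r 3 s) (3 * r 2 s * r 1 s)
          linarith
        rw [abs_div, abs_mul, abs_of_pos hδ, abs_of_pos (pow_pos hβ 2)]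
        refine div_le_div_of_nonneg_right ?_ hδ.le
        nlinarith [pow_pos hβ 2]
      have d1 : |iteratedDeriv 3 ψ (v s) * (r 1 s / δ) ^ 3| ≤ K * (R ^ 3 / δ ^ 3) := by
        rw [abs_mul]; exact mul_le_mul (hK3 _) c1 (abs_nonneg _) hK0
      have d2 : |iteratedDeriv 2 ψ (v s) * (3 * β * (r 1 s * (r 2 s - r 1 s * r 1 s)) / δ ^ 2)|
          ≤ K * (6 * β * R ^ 3 / δ ^ 2) := by
        rw [abs_mul]; exact mul_le_mul (hK2 _) c2 (abs_nonneg _) hK0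
      have d3 : |iteratedDeriv 1 ψ (v s)
          * (β ^ 2 * (r 3 s - 3 * r 2 s * r 1 s + 2 * r 1 s ^ 3) / δ)|
          ≤ K * (6 * β ^ 2 * R ^ 3 / δ) := by
        rw [abs_mul]; exact mul_le_mul (hK1 _) c3 (abs_nonneg _) hK0
      refine (abs_add_three _ _ _).trans ((add_le_add (add_le_add d1 d2) d3).trans (le_of_eq ?_))
      ring
    have T := abs_sub_taylor_two_le f1 f2 f3 bound
    have hv0 : v 0 = v₀ := by simp [hv, hv₀, hZ, expPowerSum]
    have g1 : smoothExceed β δ x₀ (y + x) = ψ (v 1) := by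
      simpa using smoothExceed_line β δ x₀ y x 1
    have g0 : smoothExceed β δ x₀ y = ψ (v 0) := by
      simpa using smoothExceed_line β δ x₀ y x 0
    have hr1 : r 1 0 = ∑ j, π j * x j := by
      simp only [hr, hZ, expPowerSum, hπ, Finset.sum_div]
      simp only [pow_zero, one_mul, pow_one, zero_mul, add_zero]
      exact Finset.sum_congr rfl fun j _ => by ring
    have hr2 : r 2 0 = ∑ j, π j * x j ^ 2 := by
      simp only [hr, hZ, expPowerSum, hπ, Finset.sum_div]
      simp only [pow_zero, one_mul, zero_mul, add_zero]
      exact Finset.sum_congr rfl fun j _ => by ring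
    have L : ∑ j, iteratedDeriv 1 ψ v₀ * π j / δ * x j = iteratedDeriv 1 ψ (v 0) * (r 1 0 / δ) := by
      rw [hv0, hr1, Finset.sum_div, Finset.mul_sum]
      exact Finset.sum_congr rfl fun j _ => by ring
    have Q : ∑ j, ∑ k, ((iteratedDeriv 2 ψ v₀ / δ ^ 2 - iteratedDeriv 1 ψ v₀ * β / δ) * (π j * π k)
        + (if j = k then iteratedDeriv 1 ψ v₀ * β / δ * π j else 0)) / 2 * (x j * x k)
        = (iteratedDeriv 2 ψ (v 0) * (r 1 0 / δ) ^ 2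
          + iteratedDeriv 1 ψ (v 0) * (β * (r 2 0 - r 1 0 * r 1 0) / δ)) / 2 := by
      have q1 : r 1 0 * r 1 0 = ∑ j, ∑ k, (π j * x j) * (π k * x k) := by
        rw [hr1, Finset.sum_mul_sum]
      have q2 : ∀ j, ∑ k, ((iteratedDeriv 2 ψ v₀ / δ ^ 2 - iteratedDeriv 1 ψ v₀ * β / δ)
          * (π j * π k) + (if j = k then iteratedDeriv 1 ψ v₀ * β / δ * π j else 0)) / 2
            * (x j * x k)
          = (iteratedDeriv 2 ψ v₀ / δ ^ 2 - iteratedDeriv 1 ψ v₀ * β / δ) / 2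
            * ∑ k, (π j * x j) * (π k * x k)
            + iteratedDeriv 1 ψ v₀ * β / δ / 2 * (π j * x j ^ 2) := by
        intro j
        have : ∀ k, ((iteratedDeriv 2 ψ v₀ / δ ^ 2 - iteratedDeriv 1 ψ v₀ * β / δ)
          * (π j * π k) + (if j = k then iteratedDeriv 1 ψ v₀ * β / δ * π j else 0)) / 2
            * (x j * x k) = (iteratedDeriv 2 ψ v₀ / δ ^ 2 - iteratedDeriv 1 ψ v₀ * β / δ) / 2
            * ((π j * x j) * (π k * x k))
            + (if j = k then iteratedDeriv 1 ψ v₀ * β / δ / 2 * (π j * x j ^ 2) else 0) := by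
          intro k
          split_ifs with h
          · subst h; ring
          · ring
        simp_rw [this, Finset.sum_add_distrib, ← Finset.mul_sum]
        simp
      simp_rw [q2, Finset.sum_add_distrib, ← Finset.mul_sum]
      rw [hv0, hr2, div_pow, sq (r 1 0), q1]
      simp_rw [← Finset.mul_sum]
      ring
    rw [g1, g0, L, Q]
    exact T

/-- A smooth function between the indicators of `max w ≥ x₀ + δ` and of `max w > x₀ - δ`. -/
lemma exists_smooth_exceed : ∃ K : ℝ, 0 < K ∧ ∀ (J : Type) [Fintype J] [Nonempty J] (δ x₀ : ℝ),
    0 < δ → ∃ g : (J → ℝ) → ℝ, Measurable g ∧ (∀ w, 0 ≤ g w ∧ g w ≤ 1) ∧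
      (∀ w, (∃ j, x₀ + δ ≤ w j) → g w = 1) ∧ (∀ w, (∀ j, w j ≤ x₀ - δ) → g w = 0) ∧
      HasTaylorBound g (K * (1 + Real.log (Fintype.card J)) / δ ^ 2)
        (K * (1 + Real.log (Fintype.card J)) ^ 2 / δ ^ 3) := by
  obtain ⟨K, hK0, hK⟩ := exists_bound_iteratedDeriv_smoothTransition
  refine ⟨13 * K, by positivity, fun J _ _ δ x₀ hδ => ?_⟩
  set Λ : ℝ := 1 + Real.log (Fintype.card J) with hΛ
  have hcard : (1 : ℝ) ≤ Fintype.card J := by exact_mod_cast Fintype.card_pos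
  have hlog : 0 ≤ Real.log (Fintype.card J) := Real.log_nonneg hcard
  have hΛ1 : 1 ≤ Λ := by linarith
  have hβ : 0 < Λ / δ := by positivity
  refine ⟨smoothExceed (Λ / δ) δ x₀, ?_, fun w => ⟨Real.smoothTransition.nonneg _,
    Real.smoothTransition.le_one _⟩, ?_, ?_, ?_⟩
  · have : Measurable fun w : J → ℝ => (Real.log (∑ j, Real.exp (Λ / δ * w j)) / (Λ / δ) - x₀) / δ := by
      fun_prop
    exact Real.smoothTransition.continuous.measurable.comp this
  · rintro w ⟨j, hj⟩
    refine Real.smoothTransition.one_of_one_le ?_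
    rw [le_div_iff₀ hδ, one_mul, le_sub_iff_add_le, le_div_iff₀ hβ]
    have h1 : Real.exp (Λ / δ * w j) ≤ ∑ k, Real.exp (Λ / δ * w k) :=
      Finset.single_le_sum (f := fun k => Real.exp (Λ / δ * w k))
        (fun k _ => (Real.exp_pos _).le) (Finset.mem_univ j)
    have h2 := Real.log_le_log (Real.exp_pos _) h1
    rw [Real.log_exp] at h2
    nlinarith
  · intro w hw
    refine Real.smoothTransition.zero_of_nonpos (div_nonpos_of_nonpos_of_nonneg ?_ hδ.le)
    rw [sub_nonpos, div_le_iff₀ hβ]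
    have h1 : ∑ k, Real.exp (Λ / δ * w k) ≤ Fintype.card J * Real.exp (Λ / δ * (x₀ - δ)) := by
      calc _ ≤ ∑ k : J, Real.exp (Λ / δ * (x₀ - δ)) := by
            gcongr with k
            exact hw k
        _ = _ := by simp
    have h2 := Real.log_le_log
      (Finset.sum_pos (fun j _ => Real.exp_pos _) Finset.univ_nonempty) h1
    rw [Real.log_mul (by positivity) (Real.exp_ne_zero _), Real.log_exp] at h2
    have h3 : Λ / δ * (x₀ - δ) = x₀ * (Λ / δ) - Λ := by field_simp
    linarith
  · intro y
    obtain ⟨c, q, hq, hR⟩ := hasTaylorBound_smoothExceed (J := J) hK hβ hδ x₀ y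
    refine ⟨c, q, hq.trans ?_, fun x => (hR x).trans ?_⟩
    · rw [show K / δ ^ 2 + 2 * (Λ / δ) * K / δ = (K + 2 * Λ * K) / δ ^ 2 by field_simp]
      gcongr
      nlinarith
    · refine mul_le_mul_of_nonneg_right ?_ (by positivity)
      rw [show K / δ ^ 3 + 6 * (Λ / δ) * K / δ ^ 2 + 6 * (Λ / δ) ^ 2 * K / δ
        = (K + 6 * Λ * K + 6 * Λ ^ 2 * K) / δ ^ 3 by field_simp]
      gcongr
      nlinarith [mul_nonneg hK0.le (by nlinarith : 0 ≤ Λ ^ 2 - Λ),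
        mul_nonneg hK0.le (by nlinarith : 0 ≤ Λ ^ 2 - 1)]

lemma charFunDual_gaussianReal_zero_one (L : StrongDual ℝ ℝ) :
    charFunDual (gaussianReal 0 1) L = Complex.exp (-(L 1 ^ 2 : ℝ) / 2) := by
  have h := charFun_gaussianReal (μ := 0) (v := 1) (L 1)
  rw [charFun_apply_real] at h
  rw [charFunDual_apply]
  convert h using 1
  · refine integral_congr_ae (Eventually.of_forall fun x => ?_)
    have : L x = L 1 * x := by
      rw [mul_comm, ← smul_eq_mul, ← map_smul, smul_eq_mul, mul_one]
    simp [this]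
  · push_cast; congr 1; simp; ring

lemma charFunDual_pi_gaussianReal {ι : Type*} [Fintype ι] [DecidableEq ι]
    (L : StrongDual ℝ (ι → ℝ)) :
    charFunDual (Measure.pi fun _ : ι => gaussianReal 0 1) L
      = Complex.exp (-(∑ i, L (Pi.single i 1) ^ 2 : ℝ) / 2) := by
  rw [charFunDual_pi]
  simp_rw [charFunDual_gaussianReal_zero_one]
  rw [← Complex.exp_sum]
  congr 1
  push_cast
  rw [← Finset.sum_neg_distrib, Finset.sum_div]
  simp

lemma pi_gaussianReal_map_smul_sum {ι : Type*} [Fintype ι] (M : ℕ) {c : ℝ}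
    (hc : c ^ 2 * M = 1) :
    (Measure.pi fun _ : Fin M => Measure.pi fun _ : ι => gaussianReal 0 1).map
      (fun Ξ => c • ∑ m, Ξ m) = Measure.pi fun _ : ι => gaussianReal 0 1 := by
  classical
  let Φ : (Fin M → ι → ℝ) →L[ℝ] (ι → ℝ) :=
    c • ∑ m, ContinuousLinearMap.proj (R := ℝ) (φ := fun _ : Fin M => ι → ℝ) m
  have hΦ : (fun Ξ : Fin M → ι → ℝ => c • ∑ m, Ξ m) = Φ := by
    ext Ξ i; simp [Φ]
  rw [hΦ]
  have : IsProbabilityMeasure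
      ((Measure.pi fun _ : Fin M => Measure.pi fun _ : ι => gaussianReal 0 1).map Φ) :=
    Measure.isProbabilityMeasure_map Φ.continuous.measurable.aemeasurable
  refine Measure.ext_of_charFunDual (funext fun L => ?_)
  rw [charFunDual_map, charFunDual_pi]
  simp_rw [charFunDual_pi_gaussianReal]
  rw [← Complex.exp_sum]
  congr 1
  have hv : ∀ (m : Fin M) (x : ι → ℝ),
      ((L ∘L Φ) ∘L (ContinuousLinearMap.single ℝ (fun _ : Fin M => ι → ℝ) m)) x = c * L x := by
    intro m x
    have : Φ (Pi.single m x) = c • x := by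
      rw [← hΦ]
      simp [Finset.sum_pi_single']
    simp [this]
  simp_rw [hv, mul_pow, ← Finset.mul_sum]
  have hc' : (c : ℂ) ^ 2 * M = 1 := by exact_mod_cast hc
  simp only [Finset.sum_const, Finset.card_univ, Fintype.card_fin, nsmul_eq_mul]
  push_cast
  linear_combination (-(∑ i, (L (Pi.single i 1) : ℂ) ^ 2) / 2) * hc'

lemma pi_gaussianReal_map_decomp {ι : Type*} [Fintype ι] {b : ι → ℝ} (hb : ∑ i, b i ^ 2 = 1) :
    ((gaussianReal 0 1).prod (Measure.pi fun _ : ι => gaussianReal 0 1)).map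
      (fun p => p.1 • b + (p.2 - (∑ i, b i * p.2 i) • b))
      = Measure.pi fun _ : ι => gaussianReal 0 1 := by
  classical
  let Φ : (ℝ × (ι → ℝ)) →L[ℝ] (ι → ℝ) :=
    (ContinuousLinearMap.fst ℝ ℝ (ι → ℝ)).smulRight b + (ContinuousLinearMap.snd ℝ ℝ (ι → ℝ) -
      ((∑ i, b i • ContinuousLinearMap.proj (R := ℝ) (φ := fun _ : ι => ℝ) i) ∘L
        ContinuousLinearMap.snd ℝ ℝ (ι → ℝ)).smulRight b)
  have hΦ : (fun p : ℝ × (ι → ℝ) => p.1 • b + (p.2 - (∑ i, b i * p.2 i) • b)) = Φ := by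
    ext p i; simp [Φ]
  rw [hΦ]
  have : IsProbabilityMeasure
      (((gaussianReal 0 1).prod (Measure.pi fun _ : ι => gaussianReal 0 1)).map Φ) :=
    Measure.isProbabilityMeasure_map Φ.continuous.measurable.aemeasurable
  refine Measure.ext_of_charFunDual (funext fun L => ?_)
  rw [charFunDual_map, charFunDual_prod, charFunDual_pi_gaussianReal,
    charFunDual_gaussianReal_zero_one, charFunDual_pi_gaussianReal, ← Complex.exp_add]
  congr 1
  have h1 : ((L ∘L Φ) ∘L ContinuousLinearMap.inl ℝ ℝ (ι → ℝ)) 1 = L b := by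
    have : Φ (1, 0) = b := by rw [← hΦ]; simp
    simp [this]
  have h2 : ∀ i, ((L ∘L Φ) ∘L ContinuousLinearMap.inr ℝ ℝ (ι → ℝ)) (Pi.single i 1)
      = L (Pi.single i 1) - b i * L b := by
    intro i
    have : Φ (0, Pi.single i 1) = Pi.single i 1 - b i • b := by
      rw [← hΦ]; simp [Pi.single_apply]
    simp [this]
  have h3 : L b = ∑ i, b i * L (Pi.single i 1) := by
    conv_lhs => rw [← Finset.univ_sum_single b, map_sum]
    refine Finset.sum_congr rfl fun i _ => ?_
    rw [← smul_eq_mul, ← map_smul, ← Pi.single_smul, smul_eq_mul, mul_one]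
  simp_rw [h1, h2]
  have h4 : ∑ i, (L (Pi.single i 1) - b i * L b) ^ 2
      = ∑ i, L (Pi.single i 1) ^ 2 - L b ^ 2 := by
    have : ∀ i, (L (Pi.single i 1) - b i * L b) ^ 2 = L (Pi.single i 1) ^ 2
        - 2 * L b * (b i * L (Pi.single i 1)) + L b ^ 2 * b i ^ 2 := fun i => by ring
    simp_rw [this, Finset.sum_add_distrib, Finset.sum_sub_distrib, ← Finset.mul_sum, hb, ← h3]
    ring
  rw [h4]
  push_cast
  ring

lemma integral_gaussianReal_mul_self : ∫ x, x * x ∂gaussianReal 0 1 = 1 := by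
  have h := variance_fun_id_gaussianReal (μ := 0) (v := 1)
  rw [variance_of_integral_eq_zero (by fun_prop) (by simp)] at h
  simpa [sq] using h

lemma integrable_norm_pow_three_pi_gaussianReal {ι : Type*} [Fintype ι] :
    Integrable (fun ξ : ι → ℝ => ‖ξ‖ ^ 3) (Measure.pi fun _ : ι => gaussianReal 0 1) := by
  have h1 : ∀ i, Integrable (fun ξ : ι → ℝ => |ξ i| ^ 3)
      (Measure.pi fun _ : ι => gaussianReal 0 1) := by
    intro i
    have h := (memLp_id_gaussianReal (μ := 0) (v := 1) 3).integrable_norm_pow (p := 3) (by norm_num)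
    exact (measurePreserving_eval (fun _ : ι => gaussianReal 0 1) i).integrable_comp_of_integrable
      (g := fun x => |x| ^ 3) h
  have h2 : Integrable (fun ξ : ι → ℝ => ∑ i, |ξ i| ^ 3)
      (Measure.pi fun _ : ι => gaussianReal 0 1) := integrable_finsetSum _ fun i _ => h1 i
  refine h2.mono' (by fun_prop) (Eventually.of_forall fun ξ => ?_)
  have hs : 0 ≤ ∑ i, |ξ i| ^ 3 := Finset.sum_nonneg fun i _ => by positivity
  rcases isEmpty_or_nonempty ι with h | h
  · have : ξ = 0 := Subsingleton.elim _ _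
    simp [this]
  · obtain ⟨i, hi⟩ := Finite.exists_max (fun i => ‖ξ i‖)
    have : ‖ξ‖ = ‖ξ i‖ := le_antisymm ((pi_norm_le_iff_of_nonneg (norm_nonneg _)).2 hi)
      (norm_le_pi_norm ξ i)
    rw [Real.norm_of_nonneg (by positivity), this, Real.norm_eq_abs]
    exact Finset.single_le_sum (f := fun i => |ξ i| ^ 3) (fun i _ => by positivity)
      (Finset.mem_univ i)

lemma integral_mul_pi_gaussianReal {ι : Type*} [Fintype ι] [DecidableEq ι] (i k : ι) :
    ∫ ξ, ξ i * ξ k ∂(Measure.pi fun _ : ι => gaussianReal 0 1) = if i = k then 1 else 0 := by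
  split_ifs with h
  · subst h
    rw [← integral_gaussianReal_mul_self]
    exact integral_comp_eval (μ := fun _ : ι => gaussianReal 0 1) (i := i)
      (f := fun x : ℝ => x * x) (by fun_prop)
  · have hI : IndepFun (fun ξ : ι → ℝ => ξ i) (fun ξ => ξ k)
        (Measure.pi fun _ : ι => gaussianReal 0 1) :=
      (iIndepFun_pi (μ := fun _ : ι => gaussianReal 0 1) (X := fun _ x => x)
        (fun i => aemeasurable_id)).indepFun h
    rw [hI.integral_fun_mul_eq_mul_integral (measurable_pi_apply i).aestronglyMeasurable
      (measurable_pi_apply k).aestronglyMeasurable]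
    rw [integral_comp_eval (μ := fun _ : ι => gaussianReal 0 1) (i := i)
      (f := fun x : ℝ => x) (by fun_prop)]
    simp

lemma integrable_mul_pi_gaussianReal {ι : Type*} [Fintype ι] (i k : ι) :
    Integrable (fun ξ : ι → ℝ => ξ i * ξ k) (Measure.pi fun _ : ι => gaussianReal 0 1) :=
  (integrable_coord_of_norm_pow_three (φ := fun ξ : ι → ℝ => ξ) _ measurable_id
    integrable_norm_pow_three_pi_gaussianReal i k).2

lemma integral_sum_mul_sum_pi_gaussianReal {ι : Type*} [Fintype ι] (a b : ι → ℝ) :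
    ∫ ξ, (∑ i, a i * ξ i) * (∑ i, b i * ξ i) ∂(Measure.pi fun _ : ι => gaussianReal 0 1)
      = ∑ i, a i * b i := by
  classical
  have h : ∀ ξ : ι → ℝ, (∑ i, a i * ξ i) * (∑ i, b i * ξ i)
      = ∑ i, ∑ k, (a i * b k) * (ξ i * ξ k) := by
    intro ξ
    rw [Finset.sum_mul_sum]
    exact Finset.sum_congr rfl fun i _ => Finset.sum_congr rfl fun k _ => by ring
  simp_rw [h]
  rw [integral_finsetSum _ fun i _ => integrable_finsetSum _ fun k _ =>
    (integrable_mul_pi_gaussianReal i k).const_mul _]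
  refine Finset.sum_congr rfl fun i _ => ?_
  rw [integral_finsetSum _ fun k _ => (integrable_mul_pi_gaussianReal i k).const_mul _]
  simp_rw [integral_const_mul, integral_mul_pi_gaussianReal]
  simp

lemma integral_sum_pi_gaussianReal {ι : Type*} [Fintype ι] (a : ι → ℝ) :
    ∫ ξ, ∑ i, a i * ξ i ∂(Measure.pi fun _ : ι => gaussianReal 0 1) = 0 := by
  have hi : ∀ i, Integrable (fun ξ : ι → ℝ => ξ i) (Measure.pi fun _ : ι => gaussianReal 0 1) :=
    fun i => (integrable_coord_of_norm_pow_three (φ := fun ξ : ι → ℝ => ξ) _ measurable_id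
      integrable_norm_pow_three_pi_gaussianReal i i).1
  rw [integral_finsetSum _ fun i _ => (hi i).const_mul _]
  refine Finset.sum_eq_zero fun i _ => ?_
  rw [integral_const_mul, integral_comp_eval (μ := fun _ : ι => gaussianReal 0 1) (i := i)
      (f := fun x : ℝ => x) (by fun_prop)]
  simp

lemma integrable_norm_pow_three_linear_pi_gaussianReal {ι J : Type*} [Fintype ι] [Fintype J]
    (a : J → ι → ℝ) :
    Integrable (fun ξ : ι → ℝ => ‖fun j => ∑ i, a j i * ξ i‖ ^ 3)
      (Measure.pi fun _ : ι => gaussianReal 0 1) := by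
  let B : ℝ := ∑ j, ∑ i, |a j i|
  have hB : 0 ≤ B := Finset.sum_nonneg fun _ _ => Finset.sum_nonneg fun _ _ => abs_nonneg _
  refine (integrable_norm_pow_three_pi_gaussianReal.const_mul (B ^ 3)).mono'
    ((by fun_prop : Measurable fun (ξ : ι → ℝ) (j : J) => ∑ i, a j i * ξ i).norm.pow_const
      3).aestronglyMeasurable (Eventually.of_forall fun ξ => ?_)
  rw [Real.norm_of_nonneg (by positivity), ← mul_pow]
  refine pow_le_pow_left₀ (norm_nonneg _) ((pi_norm_le_iff_of_nonneg (by positivity)).2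
    fun j => ?_) 3
  calc ‖∑ i, a j i * ξ i‖ ≤ ∑ i, |a j i| * ‖ξ‖ := by
        refine (norm_sum_le _ _).trans (Finset.sum_le_sum fun i _ => ?_)
        rw [norm_mul, Real.norm_eq_abs]
        exact mul_le_mul_of_nonneg_left (norm_le_pi_norm ξ i) (abs_nonneg _)
    _ = (∑ i, |a j i|) * ‖ξ‖ := by rw [Finset.sum_mul]
    _ ≤ B * ‖ξ‖ := by
        refine mul_le_mul_of_nonneg_right ?_ (norm_nonneg _)
        exact Finset.single_le_sum (f := fun j => ∑ i, |a j i|)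
          (fun _ _ => Finset.sum_nonneg fun _ _ => abs_nonneg _) (Finset.mem_univ j)

lemma integral_pi_pi_gaussianReal_linear {ι J : Type*} [Fintype ι] [Fintype J]
    (a : J → ι → ℝ) {g : (J → ℝ) → ℝ} (hg : Measurable g) (M : ℕ) {c : ℝ}
    (hc : c ^ 2 * M = 1) :
    ∫ Ξ : Fin M → ι → ℝ, g (0 + ∑ m, fun j => ∑ i, (c * a j i) * Ξ m i)
        ∂(Measure.pi fun _ : Fin M => Measure.pi fun _ : ι => gaussianReal 0 1)
      = ∫ ξ, g (fun j => ∑ i, a j i * ξ i) ∂(Measure.pi fun _ : ι => gaussianReal 0 1) := by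
  conv_rhs => rw [← pi_gaussianReal_map_smul_sum M hc]
  rw [integral_map (by fun_prop)]
  · refine integral_congr_ae (Eventually.of_forall fun Ξ => ?_)
    simp only [zero_add]
    congr 1
    ext j
    simp only [Finset.sum_apply, Pi.smul_apply, smul_eq_mul]
    rw [Finset.sum_comm]
    refine Finset.sum_congr rfl fun i _ => ?_
    rw [Finset.mul_sum, Finset.mul_sum]
    exact Finset.sum_congr rfl fun m _ => by ring
  · exact (hg.comp (by fun_prop)).aestronglyMeasurable

lemma abs_integral_linear_gaussian_sub_le {ι J : Type*} [Fintype ι] [Fintype J]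
    (a a' : J → ι → ℝ) {g : (J → ℝ) → ℝ} (hg : Measurable g) (hg1 : ∀ w, |g w| ≤ 1)
    {D₂ D₃ Δ : ℝ} (hΔ : 0 ≤ Δ) (hT : HasTaylorBound g D₂ D₃)
    (hv : ∀ j k, |∑ i, a j i * a k i - ∑ i, a' j i * a' k i| ≤ Δ) :
    |∫ ξ, g (fun j => ∑ i, a j i * ξ i) ∂(Measure.pi fun _ : ι => gaussianReal 0 1)
      - ∫ ξ, g (fun j => ∑ i, a' j i * ξ i) ∂(Measure.pi fun _ : ι => gaussianReal 0 1)|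
      ≤ D₂ * Δ := by
  set γ := Measure.pi fun _ : ι => gaussianReal 0 1 with hγ
  set K : ℝ := ∫ ξ, ‖fun j => ∑ i, a j i * ξ i‖ ^ 3 ∂γ + ∫ ξ, ‖fun j => ∑ i, a' j i * ξ i‖ ^ 3 ∂γ
  have key : ∀ M : ℕ, |∫ ξ, g (fun j => ∑ i, a j i * ξ i) ∂γ
      - ∫ ξ, g (fun j => ∑ i, a' j i * ξ i) ∂γ|
      ≤ D₂ * Δ + D₃ * K * (Real.sqrt (M + 1 : ℝ))⁻¹ := by
    intro M
    set c : ℝ := (Real.sqrt (M + 1 : ℝ))⁻¹ with hcdef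
    have hc0 : 0 < c := by positivity
    have hc : c ^ 2 * ((M + 1 : ℕ) : ℝ) = 1 := by
      rw [hcdef, inv_pow, Real.sq_sqrt (by positivity)]
      push_cast
      field_simp
    have hscale : ∀ (b : J → ι → ℝ) (ξ : ι → ℝ),
        (fun j => ∑ i, (c * b j i) * ξ i) = c • fun j => ∑ i, b j i * ξ i := by
      intro b ξ
      ext j
      simp [Finset.mul_sum, mul_assoc]
    have hn : ∀ b : J → ι → ℝ, ∫ ξ, ‖fun j => ∑ i, (c * b j i) * ξ i‖ ^ 3 ∂γ
        = c ^ 3 * ∫ ξ, ‖fun j => ∑ i, b j i * ξ i‖ ^ 3 ∂γ := by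
      intro b
      simp_rw [hscale, norm_smul, mul_pow, integral_const_mul, Real.norm_of_nonneg hc0.le]
    have hcov : ∀ (b : J → ι → ℝ) (j k : J),
        ∫ ξ, (∑ i, (c * b j i) * ξ i) * (∑ i, (c * b k i) * ξ i) ∂γ
          = c ^ 2 * ∑ i, b j i * b k i := by
      intro b j k
      rw [hγ, integral_sum_mul_sum_pi_gaussianReal, Finset.mul_sum]
      exact Finset.sum_congr rfl fun i _ => by ring
    have h1 := abs_integral_sub_le_of_taylor γ γ
      (φ := fun ξ j => ∑ i, (c * a j i) * ξ i) (by fun_prop)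
      (φ' := fun ξ j => ∑ i, (c * a' j i) * ξ i) (by fun_prop) hg hg1
      (Δ := c ^ 2 * Δ) (by positivity) hT
      (integrable_norm_pow_three_linear_pi_gaussianReal _)
      (integrable_norm_pow_three_linear_pi_gaussianReal _)
      (fun j => by
        rw [hγ]
        exact (integral_sum_pi_gaussianReal _).trans (integral_sum_pi_gaussianReal _).symm)
      (fun j k => by
        simp only [hcov]
        rw [← mul_sub, abs_mul, abs_of_pos (by positivity : 0 < c ^ 2)]
        exact mul_le_mul_of_nonneg_left (hv j k) (by positivity))
    have h2 := abs_integral_sum_sub_le γ γ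
      (φ := fun ξ j => ∑ i, (c * a j i) * ξ i) (by fun_prop)
      (φ' := fun ξ j => ∑ i, (c * a' j i) * ξ i) (by fun_prop) hg hg1 h1 (M + 1) 0
    rw [hγ, integral_pi_pi_gaussianReal_linear a hg (M + 1) hc,
      integral_pi_pi_gaussianReal_linear a' hg (M + 1) hc, ← hγ] at h2
    refine h2.trans (le_of_eq ?_)
    rw [hn, hn]
    have : c ^ 3 = c ^ 2 * c := by ring
    rw [this]
    linear_combination (D₂ * Δ + D₃ * K * c) * hc
  have hlim : Tendsto (fun M : ℕ => D₂ * Δ + D₃ * K * (Real.sqrt (M + 1 : ℝ))⁻¹) atTop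
      (nhds (D₂ * Δ + D₃ * K * 0)) := by
    refine (Tendsto.const_mul _ ?_).const_add _
    refine tendsto_inv_atTop_zero.comp (Real.tendsto_sqrt_atTop.comp ?_)
    exact tendsto_atTop_add_const_right _ _ tendsto_natCast_atTop_atTop
  have := ge_of_tendsto' hlim key
  simpa using this

lemma integral_pi_prod_eq_integral_integral {Ω Ω' : Type*} [MeasurableSpace Ω]
    [MeasurableSpace Ω'] (κ : Measure Ω) [IsProbabilityMeasure κ] (ν : Measure Ω')
    [IsProbabilityMeasure ν] (n : ℕ) {F : (Fin n → Ω) × (Fin n → Ω') → ℝ} (hF : Measurable F)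
    (hF1 : ∀ p, |F p| ≤ 1) :
    ∫ p, F (fun i => (p i).1, fun i => (p i).2) ∂(Measure.pi fun _ : Fin n => κ.prod ν)
      = ∫ ω, ∫ ξ, F (ω, ξ) ∂(Measure.pi fun _ : Fin n => ν) ∂(Measure.pi fun _ : Fin n => κ) := by
  have hmp := measurePreserving_arrowProdEquivProdArrow Ω Ω' (Fin n) (fun _ => κ) (fun _ => ν)
  rw [← integral_prod F (integrable_comp_of_abs_le_one _ hF hF1 measurable_id),
    ← hmp.integral_comp']
  rfl

lemma abs_integral_sum_sub_multiplier_le : ∃ C₀ > (0 : ℝ), ∀ {Ω J : Type} [MeasurableSpace Ω]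
    [Fintype J] (κ : Measure Ω) [IsProbabilityMeasure κ] {X : Ω → J → ℝ} (_ : Measurable X)
    {B : ℝ} (_ : 0 ≤ B) (_ : ∀ᵐ ω ∂κ, ‖X ω‖ ≤ B) (_ : ∀ j, ∫ ω, X ω j ∂κ = 0)
    {g : (J → ℝ) → ℝ} (_ : Measurable g) (_ : ∀ w, |g w| ≤ 1) {D₂ D₃ : ℝ} (_ : 0 ≤ D₃)
    (_ : HasTaylorBound g D₂ D₃) {n : ℕ} (_ : 0 < n),
    |∫ ω, g (fun j => (∑ i, X (ω i) j) / Real.sqrt n) ∂(Measure.pi fun _ : Fin n => κ)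
      - ∫ ω, ∫ ξ, g (fun j => ∑ i, (X (ω i) j / Real.sqrt n) * ξ i)
        ∂(Measure.pi fun _ : Fin n => gaussianReal 0 1) ∂(Measure.pi fun _ : Fin n => κ)|
      ≤ C₀ * D₃ * B ^ 3 / Real.sqrt n := by
  have hγ3 : Integrable (fun x : ℝ => |x| ^ 3) (gaussianReal 0 1) :=
    (memLp_id_gaussianReal (μ := 0) (v := 1) 3).integrable_norm_pow (p := 3) (by norm_num)
  have hγpos : 0 ≤ ∫ x, |x| ^ 3 ∂gaussianReal 0 1 := integral_nonneg fun x => by positivity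
  refine ⟨1 + ∫ x, |x| ^ 3 ∂gaussianReal 0 1, by positivity, ?_⟩
  intro Ω J _ _ κ _ X hX B hB hXB hX0 g hg hg1 D₂ D₃ hD₃ hT n hn
  set c : ℝ := (Real.sqrt n)⁻¹ with hcdef
  have hn' : (0 : ℝ) < n := by exact_mod_cast hn
  have hc0 : 0 < c := by positivity
  have hc : (n : ℝ) * c ^ 2 = 1 := by
    rw [hcdef, inv_pow, Real.sq_sqrt hn'.le]
    field_simp
  have hXi : Integrable (fun ω => ‖X ω‖ ^ 3) κ := by
    refine Integrable.of_bound (by fun_prop) (B ^ 3) (hXB.mono fun ω h => ?_)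
    rw [Real.norm_of_nonneg (by positivity)]
    exact pow_le_pow_left₀ (norm_nonneg _) h 3
  have hXint : ∫ ω, ‖X ω‖ ^ 3 ∂κ ≤ B ^ 3 := by
    have := integral_mono_ae hXi (integrable_const (B ^ 3))
      (hXB.mono fun ω h => pow_le_pow_left₀ (norm_nonneg _) h 3)
    simpa using this
  have e1 : ∀ ω, ‖c • X ω‖ ^ 3 = c ^ 3 * ‖X ω‖ ^ 3 := fun ω => by
    rw [norm_smul, mul_pow, Real.norm_of_nonneg hc0.le]
  have e2 : ∀ p : Ω × ℝ, ‖p.2 • c • X p.1‖ ^ 3 = (c ^ 3 * ‖X p.1‖ ^ 3) * |p.2| ^ 3 := fun p => by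
    rw [norm_smul, mul_pow, e1, Real.norm_eq_abs, mul_comm]
  have h3 : Integrable (fun ω => ‖c • X ω‖ ^ 3) κ := by
    simp_rw [e1]
    exact hXi.const_mul _
  have h3' : Integrable (fun p : Ω × ℝ => ‖p.2 • c • X p.1‖ ^ 3) (κ.prod (gaussianReal 0 1)) := by
    simp_rw [e2]
    exact (hXi.const_mul _).mul_prod hγ3
  have h1 := abs_integral_sub_le_of_taylor κ (κ.prod (gaussianReal 0 1))
    (φ := fun ω => c • X ω) (by fun_prop)
    (φ' := fun p => p.2 • c • X p.1) (by fun_prop) hg hg1 le_rfl hT h3 h3'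
    (fun j => by
      have h := integral_prod_mul (μ := κ) (ν := gaussianReal 0 1) (fun ω => c * X ω j)
        (fun x : ℝ => x)
      simp only [integral_const_mul, hX0, mul_zero, zero_mul] at h
      simp only [Pi.smul_apply, smul_eq_mul, integral_const_mul, hX0, mul_zero]
      refine h.symm.trans (integral_congr_ae (Eventually.of_forall fun p => ?_))
      dsimp only
      ring)
    (fun j k => by
      have h := integral_prod_mul (μ := κ) (ν := gaussianReal 0 1)
        (fun ω => (c * X ω j) * (c * X ω k)) (fun x : ℝ => x * x)
      rw [integral_gaussianReal_mul_self, mul_one] at h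
      simp only [Pi.smul_apply, smul_eq_mul]
      rw [← h, sub_eq_zero.2, abs_zero]
      exact integral_congr_ae (Eventually.of_forall fun p => by ring))
  have h2 := abs_integral_sum_sub_le κ (κ.prod (gaussianReal 0 1))
    (φ := fun ω => c • X ω) (by fun_prop)
    (φ' := fun p => p.2 • c • X p.1) (by fun_prop) hg hg1 h1 n 0
  have hF := integral_pi_prod_eq_integral_integral κ (gaussianReal 0 1) n
    (F := fun p => g (fun j => ∑ i, (X (p.1 i) j / Real.sqrt n) * p.2 i))
    (hg.comp (by fun_prop)) (fun p => hg1 _)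
  have e3 : ∀ p : Fin n → Ω × ℝ, (0 + ∑ i, (p i).2 • c • X (p i).1)
      = fun j => ∑ i, (X (p i).1 j / Real.sqrt n) * (p i).2 := by
    intro p
    ext j
    simp only [zero_add, Finset.sum_apply, Pi.smul_apply, smul_eq_mul]
    exact Finset.sum_congr rfl fun i _ => by rw [hcdef]; ring
  have e4 : ∀ ω : Fin n → Ω, (0 + ∑ i, c • X (ω i))
      = fun j => (∑ i, X (ω i) j) / Real.sqrt n := by
    intro ω
    ext j
    simp only [zero_add, Finset.sum_apply, Pi.smul_apply, smul_eq_mul, ← Finset.mul_sum]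
    rw [hcdef]; ring
  simp only [e3, e4] at h2
  rw [hF] at h2
  refine h2.trans ?_
  simp_rw [e1, e2]
  rw [integral_const_mul, integral_prod_mul (μ := κ) (ν := gaussianReal 0 1)
    (fun ω => c ^ 3 * ‖X ω‖ ^ 3) (fun x : ℝ => |x| ^ 3), integral_const_mul]
  set I := ∫ ω, ‖X ω‖ ^ 3 ∂κ
  set G := ∫ x, |x| ^ 3 ∂gaussianReal 0 1
  have : (n : ℝ) * (D₂ * 0 + D₃ * (c ^ 3 * I + c ^ 3 * I * G)) = (1 + G) * D₃ * I * c := by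
    linear_combination (D₃ * c * I * (1 + G)) * hc
  rw [this, div_eq_mul_inv]
  gcongr

lemma gaussianPDFReal_zero_one_le {x y : ℝ} (h : x ^ 2 ≤ y ^ 2) :
    gaussianPDFReal 0 1 y ≤ gaussianPDFReal 0 1 x := by
  simp only [gaussianPDFReal, sub_zero, NNReal.coe_one, mul_one]
  gcongr

lemma gaussianReal_Icc_le {b ε : ℝ} (hε : 0 ≤ ε) :
    gaussianReal 0 1 (Icc b (b + ε)) ≤ ENNReal.ofReal (ε * gaussianPDFReal 0 1 (max b 0)) := by
  rw [gaussianReal_apply 0 one_ne_zero]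
  calc ∫⁻ x in Icc b (b + ε), gaussianPDF 0 1 x
      ≤ ∫⁻ _ in Icc b (b + ε), ENNReal.ofReal (gaussianPDFReal 0 1 (max b 0)) := by
        refine setLIntegral_mono measurable_const fun x hx => ?_
        refine ENNReal.ofReal_le_ofReal (gaussianPDFReal_zero_one_le ?_)
        rcases le_total b 0 with h | h
        · rw [max_eq_right h]; nlinarith [sq_nonneg x]
        · rw [max_eq_left h]; exact pow_le_pow_left₀ h hx.1 2
    _ = _ := by
        rw [setLIntegral_const, Real.volume_Icc, add_sub_cancel_left, mul_comm,
          ENNReal.ofReal_mul hε]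

lemma le_gaussianReal_Ioi (b : ℝ) :
    ENNReal.ofReal (Real.exp (-(3 / 2)) / (max b 0 + 1) * gaussianPDFReal 0 1 (max b 0))
      ≤ gaussianReal 0 1 (Ioi b) := by
  set b' := max b 0 with hb'
  have hb0 : 0 ≤ b' := le_max_right _ _
  set h : ℝ := 1 / (b' + 1) with hh
  have hh0 : 0 < h := by positivity
  have hh1 : h ≤ 1 := by rw [hh, div_le_one (by positivity)]; linarith
  have hbh : b' * h ≤ 1 := by rw [hh, mul_one_div, div_le_one (by positivity)]; linarith
  calc ENNReal.ofReal (Real.exp (-(3 / 2)) / (b' + 1) * gaussianPDFReal 0 1 b')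
      = ∫⁻ _ in Ioc b' (b' + h), ENNReal.ofReal (Real.exp (-(3 / 2)) * gaussianPDFReal 0 1 b') := by
        rw [setLIntegral_const, Real.volume_Ioc, add_sub_cancel_left, mul_comm _ (ENNReal.ofReal h),
          ← ENNReal.ofReal_mul hh0.le, hh]
        congr 1; ring
    _ ≤ ∫⁻ x in Ioc b' (b' + h), gaussianPDF 0 1 x := by
        refine setLIntegral_mono (measurable_gaussianPDF 0 1) fun x hx => ?_
        refine ENNReal.ofReal_le_ofReal ?_
        simp only [gaussianPDFReal, sub_zero, NNReal.coe_one, mul_one]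
        rw [mul_left_comm, ← Real.exp_add]
        gcongr
        have h1 : x ^ 2 ≤ (b' + h) ^ 2 := pow_le_pow_left₀ (hb0.trans hx.1.le) hx.2 2
        nlinarith [mul_nonneg hb0 hh0.le]
    _ = gaussianReal 0 1 (Ioc b' (b' + h)) := (gaussianReal_apply 0 one_ne_zero _).symm
    _ ≤ gaussianReal 0 1 (Ioi b) := measure_mono fun x hx => (le_max_left b 0).trans_lt hx.1

lemma gaussianReal_inter_Ioc_le {U : Set ℝ} (hU : IsUpperSet U) {a s ε : ℝ} (hs : 0 ≤ s)
    (has : a ≤ s) (hε : 0 ≤ ε) :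
    gaussianReal 0 1 (U ∩ Ioc a (a + ε))
      ≤ ENNReal.ofReal (Real.exp (3 / 2) * ε * (1 + s + ε)) * gaussianReal 0 1 (U ∩ Ioi a) := by
  rcases (U ∩ Ioc a (a + ε)).eq_empty_or_nonempty with h0 | ⟨y, hyU, hy⟩
  · simp [h0]
  set V := U ∩ Ioi a with hV
  have hbdd : BddBelow V := ⟨a, fun x hx => le_of_lt hx.2⟩
  have hyV : y ∈ V := ⟨hyU, hy.1⟩
  set b := sInf V with hb
  have hab : a ≤ b := le_csInf ⟨y, hyV⟩ fun x hx => le_of_lt hx.2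
  have hbε : b ≤ a + ε := (csInf_le hbdd hyV).trans hy.2
  have hsub : Ioi b ⊆ V := by
    intro x hx
    obtain ⟨v, hv, hvx⟩ := exists_lt_of_csInf_lt ⟨y, hyV⟩ hx
    exact ⟨hU hvx.le hv.1, hab.trans_lt hx⟩
  have hb' : max b 0 ≤ s + ε := max_le (by linarith) (by linarith)
  have hb0 : 0 ≤ max b 0 := le_max_right _ _
  calc gaussianReal 0 1 (U ∩ Ioc a (a + ε)) ≤ gaussianReal 0 1 (Icc b (b + ε)) := by
        refine measure_mono fun x hx => ⟨csInf_le hbdd ⟨hx.1, hx.2.1⟩, hx.2.2.trans ?_⟩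
        linarith
    _ ≤ ENNReal.ofReal (ε * gaussianPDFReal 0 1 (max b 0)) := gaussianReal_Icc_le hε
    _ ≤ ENNReal.ofReal ((Real.exp (3 / 2) * ε * (1 + s + ε)) *
          (Real.exp (-(3 / 2)) / (max b 0 + 1) * gaussianPDFReal 0 1 (max b 0))) := by
        refine ENNReal.ofReal_le_ofReal ?_
        have hp := gaussianPDFReal_nonneg 0 1 (max b 0)
        have he : Real.exp (3 / 2) * Real.exp (-(3 / 2)) = 1 := by rw [← Real.exp_add]; simp
        have : (Real.exp (3 / 2) * ε * (1 + s + ε)) *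
          (Real.exp (-(3 / 2)) / (max b 0 + 1) * gaussianPDFReal 0 1 (max b 0))
          = (ε * gaussianPDFReal 0 1 (max b 0)) * ((1 + s + ε) / (max b 0 + 1)) := by
          rw [← mul_one (ε * gaussianPDFReal 0 1 (max b 0)), ← he]; ring
        rw [this]
        refine le_mul_of_one_le_right (by positivity) ?_
        rw [one_le_div (by positivity)]
        linarith
    _ ≤ ENNReal.ofReal (Real.exp (3 / 2) * ε * (1 + s + ε)) * gaussianReal 0 1 V := by
        rw [ENNReal.ofReal_mul (by positivity)]
        gcongr
        exact (le_gaussianReal_Ioi b).trans (measure_mono hsub)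

lemma pi_gaussianReal_slice_le {ι : Type*} [Fintype ι] {b : ι → ℝ} (hb : ∑ i, b i ^ 2 = 1)
    {E E' : Set (ι → ℝ)} (hE : MeasurableSet E) (hE' : MeasurableSet E') {K : ENNReal}
    (h : ∀ v : ι → ℝ, ∑ i, b i * v i = 0 →
      gaussianReal 0 1 {u | u • b + v ∈ E'} ≤ K * gaussianReal 0 1 {u | u • b + v ∈ E}) :
    (Measure.pi fun _ : ι => gaussianReal 0 1) E'
      ≤ K * (Measure.pi fun _ : ι => gaussianReal 0 1) E := by
  have hm : Measurable fun p : ℝ × (ι → ℝ) => p.1 • b + (p.2 - (∑ i, b i * p.2 i) • b) := by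
    fun_prop
  have hslice : ∀ S : Set (ι → ℝ), MeasurableSet S →
      (Measure.pi fun _ : ι => gaussianReal 0 1) S
        = ∫⁻ ξ, gaussianReal 0 1 {u | u • b + (ξ - (∑ i, b i * ξ i) • b) ∈ S}
          ∂(Measure.pi fun _ : ι => gaussianReal 0 1) := by
    intro S hS
    conv_lhs => rw [← pi_gaussianReal_map_decomp hb]
    rw [Measure.map_apply hm hS, Measure.prod_apply_symm (hm hS)]
    rfl
  have hmeas : Measurable fun ξ : ι → ℝ =>
      gaussianReal 0 1 {u | u • b + (ξ - (∑ i, b i * ξ i) • b) ∈ E} :=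
    measurable_measure_prodMk_right (hm hE)
  rw [hslice E' hE', hslice E hE, ← lintegral_const_mul _ hmeas]
  refine lintegral_mono fun ξ => h _ ?_
  simp only [Pi.sub_apply, Pi.smul_apply, smul_eq_mul, mul_sub, Finset.sum_sub_distrib]
  have : ∀ i, b i * ((∑ k, b k * ξ k) * b i) = (∑ k, b k * ξ k) * b i ^ 2 := fun i => by ring
  simp_rw [this, ← Finset.mul_sum, hb]
  ring

lemma sum_mul_le_one_of_sq_sum_eq_one {ι : Type*} [Fintype ι] {b b' : ι → ℝ}
    (hb : ∑ i, b i ^ 2 = 1) (hb' : ∑ i, b' i ^ 2 = 1) : ∑ i, b i * b' i ≤ 1 := by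
  have : ∑ i, b i * b' i ≤ ∑ i, (b i ^ 2 + b' i ^ 2) / 2 :=
    Finset.sum_le_sum fun i _ => by nlinarith [sq_nonneg (b i - b' i)]
  rw [← Finset.sum_div, Finset.sum_add_distrib, hb, hb'] at this
  linarith

lemma pi_gaussianReal_unit_anticoncentration {ι J : Type*} [Fintype ι] [Fintype J]
    {b : J → ι → ℝ} (hb : ∀ j, ∑ i, b j i ^ 2 = 1) {r : J → ℝ} {s ε : ℝ} (hs : 0 ≤ s)
    (hr : ∀ j, r j ≤ s) (hε : 0 ≤ ε) :
    (Measure.pi fun _ : ι => gaussianReal 0 1)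
        {ξ | (∃ j, r j < ∑ i, b j i * ξ i) ∧ ∀ j, ∑ i, b j i * ξ i ≤ r j + ε}
      ≤ ENNReal.ofReal (Real.exp (3 / 2) * ε * (1 + s + ε)) := by
  classical
  set γ := Measure.pi fun _ : ι => gaussianReal 0 1 with hγ
  set K := ENNReal.ofReal (Real.exp (3 / 2) * ε * (1 + s + ε)) with hK
  let e := Fintype.equivFin J
  let W : J → (ι → ℝ) → ℝ := fun j ξ => ∑ i, b j i * ξ i - r j
  have hWm : ∀ j, Measurable (W j) := fun j => by fun_prop
  let A : J → Set (ι → ℝ) := fun j =>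
    {ξ | (∀ k, W k ξ ≤ W j ξ) ∧ ∀ k, e k < e j → W k ξ < W j ξ}
  have hA : ∀ j, MeasurableSet (A j) := by
    intro j
    have h1 : MeasurableSet {ξ | ∀ k, W k ξ ≤ W j ξ} :=
      measurableSet_setOfPred.2 (Measurable.forall fun k =>
        measurableSet_setOfPred.1 (measurableSet_le (hWm k) (hWm j)))
    have h2 : MeasurableSet {ξ | ∀ k, e k < e j → W k ξ < W j ξ} :=
      measurableSet_setOfPred.2 (Measurable.forall fun k => measurable_const.imp
        (measurableSet_setOfPred.1 (measurableSet_lt (hWm k) (hWm j))))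
    exact h1.inter h2
  have hdisj : Pairwise (Function.onFun Disjoint fun j => A j ∩ {ξ | 0 < W j ξ}) := by
    intro j k hjk
    refine Set.disjoint_left.2 fun ξ h1 h2 => ?_
    rcases lt_or_gt_of_ne (fun h => hjk (e.injective h)) with h | h
    · exact absurd (h2.1.2 j h) (not_lt.2 (h1.1.1 k))
    · exact absurd (h1.1.2 k h) (not_lt.2 (h2.1.1 j))
  have hslice : ∀ j, γ (A j ∩ {ξ | 0 < W j ξ ∧ W j ξ ≤ ε}) ≤ K * γ (A j ∩ {ξ | 0 < W j ξ}) := by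
    intro j
    refine pi_gaussianReal_slice_le (hb j)
      ((hA j).inter (measurableSet_lt measurable_const (hWm j)))
      ((hA j).inter ((measurableSet_lt measurable_const (hWm j)).inter
        (measurableSet_le (hWm j) measurable_const))) fun v hv => ?_
    have hWk : ∀ k u, W k (u • b j + v)
        = u * (∑ i, b k i * b j i) + (∑ i, b k i * v i - r k) := by
      intro k u
      simp only [W, Pi.add_apply, Pi.smul_apply, smul_eq_mul, mul_add, Finset.sum_add_distrib,
        Finset.mul_sum]
      rw [add_sub_assoc]
      congr 1
      exact Finset.sum_congr rfl fun i _ => by ring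
    have hWj : ∀ u, W j (u • b j + v) = u - r j := by
      intro u
      have : ∑ i, b j i * b j i = 1 := by rw [← hb j]; exact Finset.sum_congr rfl fun i _ => by ring
      rw [hWk, hv, this]; ring
    have hU : IsUpperSet {u : ℝ | u • b j + v ∈ A j} := by
      intro u u' huu' hu
      have hmono : ∀ k, W k (u' • b j + v) - W k (u • b j + v)
          ≤ W j (u' • b j + v) - W j (u • b j + v) := by
        intro k
        rw [hWj, hWj, hWk, hWk]
        have := sum_mul_le_one_of_sq_sum_eq_one (hb k) (hb j)
        nlinarith
      refine ⟨fun k => ?_, fun k hk => ?_⟩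
      · have := hu.1 k; have := hmono k; linarith
      · have := hu.2 k hk; have := hmono k; linarith
    convert gaussianReal_inter_Ioc_le hU hs (hr j) hε using 2
    · ext u
      simp only [mem_ofPred_eq, mem_inter_iff, hWj, mem_Ioc, sub_pos, tsub_le_iff_right, add_comm ε]
    · congr 1
      ext u
      simp only [mem_ofPred_eq, mem_inter_iff, hWj, mem_Ioi, sub_pos]
  calc γ {ξ | (∃ j, r j < ∑ i, b j i * ξ i) ∧ ∀ j, ∑ i, b j i * ξ i ≤ r j + ε}
      ≤ γ (⋃ j, A j ∩ {ξ | 0 < W j ξ ∧ W j ξ ≤ ε}) := by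
        refine measure_mono ?_
        rintro ξ ⟨⟨j₀, hj₀⟩, hle⟩
        obtain ⟨j₁, -, hj₁⟩ := Finset.exists_max_image Finset.univ (fun j => W j ξ)
          ⟨j₀, Finset.mem_univ _⟩
        obtain ⟨j, hj, hjmin⟩ := Finset.exists_min_image
          (Finset.univ.filter fun j => W j₁ ξ ≤ W j ξ) e ⟨j₁, by simp⟩
        have hj' : W j₁ ξ ≤ W j ξ := (Finset.mem_filter.1 hj).2
        refine mem_iUnion.2 ⟨j, ⟨fun k => (hj₁ k (Finset.mem_univ _)).trans hj', fun k hk => ?_⟩,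
          ?_, ?_⟩
        · by_contra hcon
          have := hjmin k (Finset.mem_filter.2 ⟨Finset.mem_univ _, hj'.trans (not_lt.1 hcon)⟩)
          exact absurd hk (not_lt.2 this)
        · have h1 := hj₁ j₀ (Finset.mem_univ _)
          have h2 : 0 < W j₀ ξ := sub_pos.2 hj₀
          exact h2.trans_le (h1.trans hj')
        · have := hle j
          simp only [W]; linarith
    _ ≤ ∑ j, γ (A j ∩ {ξ | 0 < W j ξ ∧ W j ξ ≤ ε}) := measure_iUnion_fintype_le _ _
    _ ≤ ∑ j, K * γ (A j ∩ {ξ | 0 < W j ξ}) := Finset.sum_le_sum fun j _ => hslice j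
    _ = K * γ (⋃ j, A j ∩ {ξ | 0 < W j ξ}) := by
        rw [← Finset.mul_sum, measure_iUnion hdisj
          (fun j => (hA j).inter (measurableSet_lt measurable_const (hWm j))), tsum_fintype]
    _ ≤ K * 1 := by gcongr; exact prob_le_one
    _ = K := mul_one _

lemma pi_gaussianReal_anticoncentration {ι J : Type*} [Fintype ι] [Fintype J]
    {a : J → ι → ℝ} {σ : ℝ} (hσ : 0 < σ) (ha : ∀ j, σ ^ 2 ≤ ∑ i, a j i ^ 2) {x δ : ℝ}
    (hδ : 0 ≤ δ) :
    (Measure.pi fun _ : ι => gaussianReal 0 1)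
        {ξ | (∃ j, x < ∑ i, a j i * ξ i) ∧ ∀ j, ∑ i, a j i * ξ i ≤ x + δ}
      ≤ ENNReal.ofReal (Real.exp (3 / 2) * (δ / σ) * (1 + |x| / σ + δ / σ)) := by
  let τ : J → ℝ := fun j => Real.sqrt (∑ i, a j i ^ 2)
  have hτ : ∀ j, σ ≤ τ j := fun j => Real.le_sqrt_of_sq_le (ha j)
  have hτ0 : ∀ j, 0 < τ j := fun j => hσ.trans_le (hτ j)
  have hτ2 : ∀ j, τ j ^ 2 = ∑ i, a j i ^ 2 := fun j =>
    Real.sq_sqrt (Finset.sum_nonneg fun i _ => sq_nonneg _)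
  have hb : ∀ j, ∑ i, (a j i / τ j) ^ 2 = 1 := by
    intro j
    simp_rw [div_pow, ← Finset.sum_div, hτ2]
    rw [← hτ2, div_self (by have := hτ0 j; positivity)]
  refine le_trans (measure_mono ?_) (pi_gaussianReal_unit_anticoncentration hb
    (r := fun j => x / τ j) (s := |x| / σ) (by positivity) (fun j => ?_) (by positivity))
  · rintro ξ ⟨⟨j, hj⟩, hle⟩
    have hsum : ∀ j, ∑ i, a j i / τ j * ξ i = (∑ i, a j i * ξ i) / τ j := by
      intro j
      rw [Finset.sum_div]
      exact Finset.sum_congr rfl fun i _ => by ring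
    refine ⟨⟨j, ?_⟩, fun k => ?_⟩
    · rw [hsum]; exact div_lt_div_of_pos_right hj (hτ0 j)
    · rw [hsum]
      calc _ ≤ (x + δ) / τ k := div_le_div_of_nonneg_right (hle k) (hτ0 k).le
        _ = x / τ k + δ / τ k := add_div _ _ _
        _ ≤ _ := by gcongr; exact hτ k
  · calc x / τ j ≤ |x| / τ j := div_le_div_of_nonneg_right (le_abs_self x) (hτ0 j).le
      _ ≤ _ := by gcongr; exact hτ j

lemma HasSubgaussianMGF.comp_measurePreserving {Ω Ω' : Type*} [MeasurableSpace Ω]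
    [MeasurableSpace Ω'] {μ : Measure Ω'} {κ : Measure Ω} {X : Ω → ℝ} {c : NNReal}
    (h : HasSubgaussianMGF X c κ) {f : Ω' → Ω} (hf : MeasurePreserving f μ κ) :
    HasSubgaussianMGF (fun ω => X (f ω)) c μ := by
  rw [← hf.map_eq] at h
  exact h.of_map hf.measurable.aemeasurable

lemma pi_hoeffding_le {Ω : Type*} [MeasurableSpace Ω] (κ : Measure Ω) [IsProbabilityMeasure κ]
    {Y : Ω → ℝ} (hY : Measurable Y) {B : ℝ} (hB : 0 ≤ B) (hYB : ∀ᵐ ω ∂κ, |Y ω| ≤ B) (n : ℕ)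
    {t : ℝ} (ht : 0 ≤ t) :
    (Measure.pi fun _ : Fin n => κ).real {ω | n * t ≤ ∑ i, (Y (ω i) - ∫ ω, Y ω ∂κ)}
      ≤ Real.exp (-(n * t ^ 2) / (2 * B ^ 2)) := by
  have hsub : HasSubgaussianMGF (fun ω => Y ω - ∫ ω, Y ω ∂κ) ((‖B - -B‖₊ / 2) ^ 2) κ :=
    hasSubgaussianMGF_of_mem_Icc hY.aemeasurable (hYB.mono fun ω h => abs_le.1 h)
  have hI : iIndepFun (fun (i : Fin n) (ω : Fin n → Ω) => Y (ω i) - ∫ ω, Y ω ∂κ)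
      (Measure.pi fun _ : Fin n => κ) :=
    iIndepFun_pi (μ := fun _ : Fin n => κ) (X := fun _ ω => Y ω - ∫ ω, Y ω ∂κ)
      (fun i => (hY.sub_const _).aemeasurable)
  have hs : ∀ i : Fin n, HasSubgaussianMGF (fun ω : Fin n → Ω => Y (ω i) - ∫ ω, Y ω ∂κ)
      ((‖B - -B‖₊ / 2) ^ 2) (Measure.pi fun _ : Fin n => κ) := by
    intro i
    exact HasSubgaussianMGF.comp_measurePreserving hsub
      (measurePreserving_eval (fun _ : Fin n => κ) i)
  have h := HasSubgaussianMGF.measure_sum_ge_le_of_iIndepFun hI (s := Finset.univ)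
    (fun i _ => hs i) (ε := n * t) (by positivity)
  refine h.trans (Real.exp_le_exp.2 (le_of_eq ?_))
  have hBB : ((‖B - -B‖₊ / 2) ^ 2 : NNReal) = (B ^ 2 : ℝ) := by
    push_cast
    rw [Real.norm_of_nonneg (by linarith)]
    ring
  simp only [Finset.sum_const, Finset.card_univ, Fintype.card_fin, nsmul_eq_mul]
  push_cast at hBB ⊢
  rw [hBB]
  rcases Nat.eq_zero_or_pos n with h0 | h0
  · simp [h0]
  · have : (0 : ℝ) < n := by exact_mod_cast h0
    rcases hB.eq_or_lt with h1 | h1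
    · simp [← h1]
    · field_simp

lemma pi_hoeffding_union_le {Ω Q : Type*} [MeasurableSpace Ω] [Fintype Q] (κ : Measure Ω)
    [IsProbabilityMeasure κ] {Y : Q → Ω → ℝ} (hY : ∀ q, Measurable (Y q)) {B : ℝ} (hB : 0 ≤ B)
    (hYB : ∀ q, ∀ᵐ ω ∂κ, |Y q ω| ≤ B) {n : ℕ} (hn : 0 < n) {t : ℝ} (ht : 0 ≤ t) :
    (Measure.pi fun _ : Fin n => κ)
        {ω | ∃ q, t < |(∑ i, Y q (ω i)) / n - ∫ ω, Y q ω ∂κ|}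
      ≤ ENNReal.ofReal (Fintype.card Q * (2 * Real.exp (-(n * t ^ 2) / (2 * B ^ 2)))) := by
  set μ := Measure.pi fun _ : Fin n => κ
  have hn' : (0 : ℝ) < n := by exact_mod_cast hn
  have h1 : ∀ (Z : Ω → ℝ), Measurable Z → (∀ᵐ ω ∂κ, |Z ω| ≤ B) →
      μ {ω | n * t ≤ ∑ i, (Z (ω i) - ∫ ω, Z ω ∂κ)}
        ≤ ENNReal.ofReal (Real.exp (-(n * t ^ 2) / (2 * B ^ 2))) := by
    intro Z hZ hZB
    rw [← ENNReal.ofReal_toReal (measure_ne_top μ _)]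
    exact ENNReal.ofReal_le_ofReal (pi_hoeffding_le κ hZ hB hZB n ht)
  have h2 : ∀ q, μ {ω | t < |(∑ i, Y q (ω i)) / n - ∫ ω, Y q ω ∂κ|}
      ≤ ENNReal.ofReal (2 * Real.exp (-(n * t ^ 2) / (2 * B ^ 2))) := by
    intro q
    refine (measure_mono (t := {ω | n * t ≤ ∑ i, (Y q (ω i) - ∫ ω, Y q ω ∂κ)} ∪
      {ω | n * t ≤ ∑ i, (-Y q (ω i) - ∫ ω, -Y q ω ∂κ)}) ?_).trans ((measure_union_le _ _).trans ?_)
    · intro ω hω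
      replace hω : t < |(∑ i, Y q (ω i)) / n - ∫ ω, Y q ω ∂κ| := hω
      have e1 : ∑ i, (Y q (ω i) - ∫ ω, Y q ω ∂κ)
          = n * ((∑ i, Y q (ω i)) / n - ∫ ω, Y q ω ∂κ) := by
        rw [Finset.sum_sub_distrib]; simp; field_simp
      have e2 : ∑ i, (-Y q (ω i) - ∫ ω, -Y q ω ∂κ)
          = n * -((∑ i, Y q (ω i)) / n - ∫ ω, Y q ω ∂κ) := by
        rw [Finset.sum_sub_distrib, integral_neg]; simp; field_simp; ring
      rcases lt_abs.1 hω with h | h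
      · left
        change (n : ℝ) * t ≤ _
        rw [e1]
        gcongr
      · right
        change (n : ℝ) * t ≤ _
        rw [e2]
        gcongr
    · rw [two_mul, ENNReal.ofReal_add (by positivity) (by positivity)]
      exact add_le_add (h1 _ (hY q) (hYB q))
        (h1 _ (hY q).neg ((hYB q).mono fun ω h => by rwa [Pi.neg_apply, abs_neg]))
  have h3 : {ω : Fin n → Ω | ∃ q, t < |(∑ i, Y q (ω i)) / n - ∫ ω, Y q ω ∂κ|}
      = ⋃ q, {ω | t < |(∑ i, Y q (ω i)) / n - ∫ ω, Y q ω ∂κ|} := by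
    ext ω; simp
  rw [h3]
  refine (measure_iUnion_fintype_le _ _).trans ((Finset.sum_le_sum fun q _ => h2 q).trans ?_)
  rw [Finset.sum_const, Finset.card_univ, nsmul_eq_mul,
    ENNReal.ofReal_mul (p := (Fintype.card Q : ℝ)) (by positivity), ENNReal.ofReal_natCast]

lemma hasSubgaussianMGF_gaussianReal : HasSubgaussianMGF (fun x : ℝ => x) 1 (gaussianReal 0 1) where
  integrable_exp_mul t := integrable_exp_mul_gaussianReal t
  mgf_le t := by
    rw [mgf_fun_id_gaussianReal]
    simp

lemma pi_gaussianReal_tail_le {ι : Type*} [Fintype ι] {a : ι → ℝ} {B : ℝ}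
    (ha : ∑ i, a i ^ 2 ≤ B ^ 2) {x : ℝ} (hx : 0 ≤ x) :
    (Measure.pi fun _ : ι => gaussianReal 0 1) {ξ | x < ∑ i, a i * ξ i}
      ≤ ENNReal.ofReal (Real.exp (-x ^ 2 / (2 * B ^ 2))) := by
  have hI : iIndepFun (fun (i : ι) (ξ : ι → ℝ) => a i * ξ i)
      (Measure.pi fun _ : ι => gaussianReal 0 1) :=
    iIndepFun_pi (μ := fun _ : ι => gaussianReal 0 1) (X := fun i x => a i * x)
      (fun i => by fun_prop)
  have hs : ∀ i : ι, HasSubgaussianMGF (fun ξ : ι → ℝ => a i * ξ i) (‖a i‖₊ ^ 2)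
      (Measure.pi fun _ : ι => gaussianReal 0 1) := fun i => by
    convert (HasSubgaussianMGF.comp_measurePreserving hasSubgaussianMGF_gaussianReal
      (measurePreserving_eval (fun _ : ι => gaussianReal 0 1) i)).const_mul (a i) using 1
    apply NNReal.eq
    rw [NNReal.coe_pow, coe_nnnorm, Real.norm_eq_abs, sq_abs]
    exact (mul_one (a i ^ 2)).symm
  have h := (HasSubgaussianMGF.sum_of_iIndepFun hI (s := Finset.univ)
    (fun i _ => hs i)).measure_ge_le hx
  have hsum : ((∑ i, ‖a i‖₊ ^ 2 : NNReal) : ℝ) = ∑ i, a i ^ 2 := by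
    rw [NNReal.coe_sum]
    simp
  rw [hsum] at h
  rcases (Finset.sum_nonneg fun i (_ : i ∈ Finset.univ) => sq_nonneg (a i)).eq_or_lt with h0 | h0
  · have ha0 : ∀ i, a i = 0 := fun i => by
      have := (Finset.sum_eq_zero_iff_of_nonneg fun i _ => sq_nonneg (a i)).1 h0.symm i
        (Finset.mem_univ i)
      simpa using this
    have : {ξ : ι → ℝ | x < ∑ i, a i * ξ i} = ∅ := by
      ext ξ
      simp [ha0, hx]
    simp [this]
  · rw [← ENNReal.ofReal_toReal (measure_ne_top _ {ξ : ι → ℝ | x < ∑ i, a i * ξ i})]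
    refine ENNReal.ofReal_le_ofReal ?_
    refine (measureReal_mono (s₁ := {ξ : ι → ℝ | x < ∑ i, a i * ξ i})
      (s₂ := {ξ : ι → ℝ | x ≤ ∑ i, a i * ξ i}) (ofPred_subset_ofPred.2
        fun ξ hξ => le_of_lt hξ)).trans (h.trans (Real.exp_le_exp.2 ?_))
    rw [neg_div, neg_div]
    gcongr

lemma measureReal_le_integral_of_eq_one {Ω : Type*} [MeasurableSpace Ω] {μ : Measure Ω}
    [IsProbabilityMeasure μ] {f : Ω → ℝ} (hf : Measurable f) (hf01 : ∀ ω, 0 ≤ f ω ∧ f ω ≤ 1)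
    {s : Set Ω} (hs : ∀ ω ∈ s, f ω = 1) : μ.real s ≤ ∫ ω, f ω ∂μ := by
  have hint : Integrable f μ := Integrable.of_bound hf.aestronglyMeasurable 1
    (Eventually.of_forall fun ω => by
      rw [Real.norm_eq_abs, abs_of_nonneg (hf01 ω).1]; exact (hf01 ω).2)
  have h := mul_meas_ge_le_integral_of_nonneg (Eventually.of_forall fun ω => (hf01 ω).1) hint 1
  rw [one_mul] at h
  exact (measureReal_mono (s₂ := {ω | 1 ≤ f ω}) fun ω hω => (hs ω hω).ge).trans h

lemma integral_le_measureReal_of_eq_zero {Ω : Type*} [MeasurableSpace Ω] {μ : Measure Ω}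
    [IsProbabilityMeasure μ] {f : Ω → ℝ} (hf01 : ∀ ω, 0 ≤ f ω ∧ f ω ≤ 1)
    {s : Set Ω} (hsm : MeasurableSet s) (hs : ∀ ω ∉ s, f ω = 0) : ∫ ω, f ω ∂μ ≤ μ.real s := by
  rw [← integral_indicator_one hsm]
  refine integral_mono_of_nonneg (Eventually.of_forall fun ω => (hf01 ω).1)
    ((integrable_const (1 : ℝ)).indicator hsm) (Eventually.of_forall fun ω => ?_)
  by_cases h : ω ∈ s
  · simpa [h] using (hf01 ω).2
  · simp [h, hs ω h]

/-- The probability that some coordinate of the Gaussian vector with coefficient matrix `a`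
exceeds `z`. -/
def gaussExceed {ι J : Type*} [Fintype ι] (a : J → ι → ℝ) (z : ℝ) : ℝ :=
  (Measure.pi fun _ : ι => gaussianReal 0 1).real {ξ | ∃ j, z < ∑ i, a j i * ξ i}

lemma measurableSet_exists_lt_sum {ι J : Type*} [Fintype ι] [Fintype J] (a : J → ι → ℝ) (z : ℝ) :
    MeasurableSet {ξ : ι → ℝ | ∃ j, z < ∑ i, a j i * ξ i} := by
  have h : {ξ : ι → ℝ | ∃ j, z < ∑ i, a j i * ξ i} = ⋃ j, {ξ | z < ∑ i, a j i * ξ i} := by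
    ext ξ; simp
  rw [h]
  exact MeasurableSet.iUnion fun j => measurableSet_lt (by fun_prop) (by fun_prop)

lemma gaussExceed_le_add_anticoncentration {ι J : Type*} [Fintype ι] [Fintype J]
    {a : J → ι → ℝ} {σ : ℝ} (hσ : 0 < σ) (ha : ∀ j, σ ^ 2 ≤ ∑ i, a j i ^ 2) {x δ : ℝ}
    (hδ : 0 ≤ δ) :
    gaussExceed a x ≤ gaussExceed a (x + δ)
      + Real.exp (3 / 2) * (δ / σ) * (1 + |x| / σ + δ / σ) := by
  have h := pi_gaussianReal_anticoncentration hσ ha (x := x) hδ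
  have h' := ENNReal.toReal_le_of_le_ofReal (by positivity) h
  refine (measureReal_mono (s₂ := {ξ : ι → ℝ | ∃ j, x + δ < ∑ i, a j i * ξ i} ∪
    {ξ | (∃ j, x < ∑ i, a j i * ξ i) ∧ ∀ j, ∑ i, a j i * ξ i ≤ x + δ}) ?_).trans
    ((measureReal_union_le _ _).trans (add_le_add le_rfl h'))
  intro ξ hξ
  replace hξ : ∃ j, x < ∑ i, a j i * ξ i := hξ
  by_cases h0 : ∃ j, x + δ < ∑ i, a j i * ξ i
  · exact Or.inl h0
  · push Not at h0
    exact Or.inr ⟨hξ, h0⟩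

lemma gaussExceed_le_card_mul_exp {ι J : Type*} [Fintype ι] [Fintype J]
    {a : J → ι → ℝ} {B : ℝ} (ha : ∀ j, ∑ i, a j i ^ 2 ≤ B ^ 2) {x : ℝ} (hx : 0 ≤ x) :
    gaussExceed a x ≤ Fintype.card J * Real.exp (-x ^ 2 / (2 * B ^ 2)) := by
  have h : {ξ : ι → ℝ | ∃ j, x < ∑ i, a j i * ξ i} = ⋃ j, {ξ | x < ∑ i, a j i * ξ i} := by
    ext ξ; simp
  rw [gaussExceed, h]
  refine (measureReal_iUnion_fintype_le _).trans ((Finset.sum_le_sum fun j _ =>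
    ENNReal.toReal_le_of_le_ofReal (by positivity) (pi_gaussianReal_tail_le (ha j) hx)).trans ?_)
  simp

/-- A sample whose empirical second moments and means are within `Δ` of the true ones
(the true means being zero). -/
def IsGoodSample {Ω J : Type*} [MeasurableSpace Ω] (κ : Measure Ω) (X : Ω → J → ℝ) (Δ : ℝ)
    {n : ℕ} (ω : Fin n → Ω) : Prop :=
  (∀ j k, |(∑ i, X (ω i) j * X (ω i) k) / n - ∫ ω, X ω j * X ω k ∂κ| ≤ Δ) ∧
    ∀ j, |(∑ i, X (ω i) j) / n| ≤ Δ

lemma measurableSet_isGoodSample {Ω J : Type*} [MeasurableSpace Ω] [Fintype J] (κ : Measure Ω)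
    {X : Ω → J → ℝ} (hX : Measurable X) (Δ : ℝ) (n : ℕ) :
    MeasurableSet {ω : Fin n → Ω | IsGoodSample κ X Δ ω} := by
  have hXj : ∀ j, Measurable fun ω => X ω j := fun j => (measurable_pi_apply j).comp hX
  have h : {ω : Fin n → Ω | IsGoodSample κ X Δ ω} =
      (⋂ j, ⋂ k, {ω | |(∑ i, X (ω i) j * X (ω i) k) / n - ∫ ω, X ω j * X ω k ∂κ| ≤ Δ}) ∩
        ⋂ j, {ω | |(∑ i, X (ω i) j) / n| ≤ Δ} := by
    ext ω; simp [IsGoodSample]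
  rw [h]
  refine MeasurableSet.inter ?_ ?_
  · refine MeasurableSet.iInter fun j => MeasurableSet.iInter fun k => measurableSet_le ?_ (by fun_prop)
    have := hXj j
    have := hXj k
    fun_prop
  · refine MeasurableSet.iInter fun j => measurableSet_le ?_ (by fun_prop)
    have := hXj j
    fun_prop

lemma measureReal_not_isGoodSample_le {Ω J : Type*} [MeasurableSpace Ω] [Fintype J]
    (κ : Measure Ω) [IsProbabilityMeasure κ] {X : Ω → J → ℝ} (hX : Measurable X) {B : ℝ}
    (hB : 1 ≤ B) (hXB : ∀ᵐ ω ∂κ, ‖X ω‖ ≤ B) (hX0 : ∀ j, ∫ ω, X ω j ∂κ = 0) {n : ℕ} (hn : 0 < n)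
    {Δ : ℝ} (hΔ : 0 ≤ Δ) :
    (Measure.pi fun _ : Fin n => κ).real {ω | ¬ IsGoodSample κ X Δ ω}
      ≤ (Fintype.card J ^ 2 + Fintype.card J)
        * (2 * Real.exp (-(n * Δ ^ 2) / (2 * (B ^ 2) ^ 2))) := by
  have hXj : ∀ j, Measurable fun ω => X ω j := fun j => (measurable_pi_apply j).comp hX
  have h := pi_hoeffding_union_le (Q := (J × J) ⊕ J) κ
    (Y := Sum.elim (fun p ω => X ω p.1 * X ω p.2) (fun j ω => X ω j)) (B := B ^ 2) ?_
    (by positivity) ?_ hn hΔ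
  · refine ENNReal.toReal_le_of_le_ofReal (by positivity) ((measure_mono ?_).trans (h.trans_eq ?_))
    · intro ω hω
      replace hω : ¬ IsGoodSample κ X Δ ω := hω
      rw [IsGoodSample, not_and_or] at hω
      push Not at hω
      rcases hω with ⟨j, k, hjk⟩ | ⟨j, hj⟩
      · exact ⟨Sum.inl (j, k), hjk⟩
      · refine ⟨Sum.inr j, ?_⟩
        simpa [hX0] using hj
    · congr 1
      simp only [Fintype.card_sum, Fintype.card_prod]
      push_cast
      ring
  · rintro (⟨j, k⟩ | j)
    · exact (hXj j).mul (hXj k)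
    · exact hXj j
  · have hcoord : ∀ᵐ ω ∂κ, ∀ j, |X ω j| ≤ B :=
      hXB.mono fun ω h j => (norm_le_pi_norm (X ω) j).trans h
    rintro (⟨j, k⟩ | j)
    · filter_upwards [hcoord] with ω hω
      simp only [Sum.elim_inl]
      rw [abs_mul, sq]
      exact mul_le_mul (hω j) (hω k) (abs_nonneg _) (by positivity)
    · filter_upwards [hcoord] with ω hω
      simp only [Sum.elim_inr]
      nlinarith [hω j]

lemma sum_div_sqrt_mul_div_sqrt {n : ℕ} (x y : Fin n → ℝ) :
    ∑ i, x i / Real.sqrt n * (y i / Real.sqrt n) = (∑ i, x i * y i) / n := by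
  rw [Finset.sum_div]
  refine Finset.sum_congr rfl fun i _ => ?_
  rw [div_mul_div_comm, Real.mul_self_sqrt (Nat.cast_nonneg n)]

lemma sum_sub_mean_mul_sub_mean_div {n : ℕ} (hn : 0 < n) (x y : Fin n → ℝ) :
    (∑ i, (x i - (∑ i, x i) / n) * (y i - (∑ i, y i) / n)) / n
      = (∑ i, x i * y i) / n - (∑ i, x i) / n * ((∑ i, y i) / n) := by
  have hn' : (n : ℝ) ≠ 0 := by positivity
  have h : ∀ i, (x i - (∑ i, x i) / n) * (y i - (∑ i, y i) / n)
      = x i * y i - x i * ((∑ i, y i) / n) - ((∑ i, x i) / n) * y i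
        + ((∑ i, x i) / n) * ((∑ i, y i) / n) := fun i => by ring
  simp only [h, Finset.sum_add_distrib, Finset.sum_sub_distrib, ← Finset.sum_mul,
    ← Finset.mul_sum, Finset.sum_const, Finset.card_univ, Fintype.card_fin, nsmul_eq_mul]
  field_simp
  ring

/-- The coefficient matrix of the (uncentred) multiplier process of a sample. -/
def multCoeff {Ω J : Type*} (X : Ω → J → ℝ) {n : ℕ} (ω : Fin n → Ω) (j : J) (i : Fin n) : ℝ :=
  X (ω i) j / Real.sqrt n

/-- The coefficient matrix of the centred multiplier process of a sample. -/
def multCoeffCentered {Ω J : Type*} (X : Ω → J → ℝ) {n : ℕ} (ω : Fin n → Ω) (j : J)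
    (i : Fin n) : ℝ :=
  (X (ω i) j - (∑ i, X (ω i) j) / n) / Real.sqrt n

namespace IsGoodSample

variable {Ω J : Type*} [MeasurableSpace Ω] {κ : Measure Ω} {X : Ω → J → ℝ} {Δ : ℝ} {n : ℕ}
  {ω ω' : Fin n → Ω}

lemma abs_cov_sub_le (h : IsGoodSample κ X Δ ω) (h' : IsGoodSample κ X Δ ω') (j k : J) :
    |∑ i, multCoeff X ω j i * multCoeff X ω k i - ∑ i, multCoeff X ω' j i * multCoeff X ω' k i|
      ≤ 3 * Δ := by
  simp only [multCoeff, sum_div_sqrt_mul_div_sqrt]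
  have h1 := abs_le.1 (h.1 j k)
  have h2 := abs_le.1 (h'.1 j k)
  rw [abs_le]
  constructor <;> linarith

lemma abs_cov_centered_sub_le (hn : 0 < n) (hΔ1 : Δ ≤ 1) (h : IsGoodSample κ X Δ ω)
    (h' : IsGoodSample κ X Δ ω') (j k : J) :
    |∑ i, multCoeff X ω j i * multCoeff X ω k i
      - ∑ i, multCoeffCentered X ω' j i * multCoeffCentered X ω' k i| ≤ 3 * Δ := by
  simp only [multCoeff, multCoeffCentered, sum_div_sqrt_mul_div_sqrt,
    sum_sub_mean_mul_sub_mean_div hn (fun i => X (ω' i) j) (fun i => X (ω' i) k)]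
  have h1 := abs_le.1 (h.1 j k)
  have h2 := abs_le.1 (h'.1 j k)
  have h3 : |(∑ i, X (ω' i) j) / n * ((∑ i, X (ω' i) k) / n)| ≤ Δ := by
    rw [abs_mul]
    have h4 := h'.2 j
    have h5 := h'.2 k
    nlinarith [abs_nonneg ((∑ i, X (ω' i) j) / n), abs_nonneg ((∑ i, X (ω' i) k) / n)]
  have h3 := abs_le.1 h3
  rw [abs_le]
  constructor <;> linarith

lemma sum_sq_multCoeff_mem (h : IsGoodSample κ X Δ ω) (j : J) :
    ∫ ω, X ω j ^ 2 ∂κ - Δ ≤ ∑ i, multCoeff X ω j i ^ 2 ∧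
      ∑ i, multCoeff X ω j i ^ 2 ≤ ∫ ω, X ω j ^ 2 ∂κ + Δ := by
  simp only [multCoeff, sq, sum_div_sqrt_mul_div_sqrt]
  have h1 := abs_le.1 (h.1 j j)
  constructor <;> linarith

end IsGoodSample

/-- Deterministic lower bound for the bootstrap quantile on good samples, together with the
matching upper bound for the exceedance probability of the empirical process, over a finite
index set. -/
lemma exists_threshold_exceed_le : ∃ K > (0 : ℝ), ∀ {Ω J : Type} [MeasurableSpace Ω] [Fintype J]
    [Nonempty J] (κ : Measure Ω) [IsProbabilityMeasure κ] {X : Ω → J → ℝ} (_ : Measurable X)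
    {B c δ Δ M α : ℝ} (_ : 1 ≤ B) (_ : ∀ᵐ ω ∂κ, ‖X ω‖ ≤ B) (_ : ∀ j, ∫ ω, X ω j ∂κ = 0)
    (_ : 0 < c) (_ : ∀ j, c ^ 2 ≤ ∫ ω, X ω j ^ 2 ∂κ) {n : ℕ} (_ : 0 < n) (_ : 0 < δ)
    (_ : 0 ≤ Δ) (_ : Δ ≤ 1) (_ : Δ ≤ 3 / 4 * c ^ 2) (_ : 0 ≤ M)
    (_ : Fintype.card J * Real.exp (-M ^ 2 / (2 * (2 * B) ^ 2)) ≤ α)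
    (_ : (Measure.pi fun _ : Fin n => κ).real {ω | ¬ IsGoodSample κ X Δ ω} < 1),
    ∃ ζ : ℝ, (∀ ω : Fin n → Ω, IsGoodSample κ X Δ ω → ∀ z, 0 ≤ z →
        gaussExceed (multCoeffCentered X ω) z ≤ α → ζ ≤ z) ∧
      (Measure.pi fun _ : Fin n => κ).real {ω | ∃ j, ζ - δ < (∑ i, X (ω i) j) / Real.sqrt n}
        ≤ α + (Measure.pi fun _ : Fin n => κ).real {ω | ¬ IsGoodSample κ X Δ ω}
          + K * ((1 + Real.log (Fintype.card J)) * Δ / δ ^ 2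
            + (1 + Real.log (Fintype.card J)) ^ 2 * B ^ 3 / (δ ^ 3 * Real.sqrt n)
            + δ / c * (1 + (M + δ) / c)) := by
  obtain ⟨K₁, hK₁, hsmooth⟩ := exists_smooth_exceed
  obtain ⟨C₀, hC₀, hCLT⟩ := abs_integral_sum_sub_multiplier_le
  refine ⟨6 * K₁ + C₀ * K₁ + Real.exp (3 / 2) * 12 * 26, by positivity, ?_⟩
  intro Ω J _ _ _ κ _ X hX B c δ Δ M α hB hXB hX0 hc hXc n hn hδ hΔ hΔ1 hΔc hM hMα hbad
  set Pn := Measure.pi fun _ : Fin n => κ with hPn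
  set γ := Measure.pi fun _ : Fin n => gaussianReal 0 1 with hγ
  set L := 1 + Real.log (Fintype.card J) with hL
  have hL0 : 0 ≤ L := by
    have : (1 : ℝ) ≤ Fintype.card J := by exact_mod_cast Fintype.card_pos
    have := Real.log_nonneg this
    linarith
  -- a good reference sample
  obtain ⟨ω₀, hω₀⟩ : ∃ ω₀ : Fin n → Ω, IsGoodSample κ X Δ ω₀ := by
    by_contra! hcon
    have : {ω : Fin n → Ω | ¬ IsGoodSample κ X Δ ω} = univ := by
      ext ω; simp [hcon ω]
    rw [this] at hbad
    simp at hbad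
  set H := gaussExceed (multCoeff X ω₀) with hH
  set e₁ := 3 * K₁ * (L * Δ / δ ^ 2) with he₁
  -- tail of the reference vector
  have hsq : ∀ j, ∑ i, multCoeff X ω₀ j i ^ 2 ≤ (2 * B) ^ 2 := by
    intro j
    have h1 := (hω₀.sum_sq_multCoeff_mem j).2
    have h2 : ∫ ω, X ω j ^ 2 ∂κ ≤ B ^ 2 := by
      have h3 : ∫ ω, X ω j ^ 2 ∂κ ≤ ∫ _, B ^ 2 ∂κ := by
        refine integral_mono_of_nonneg (Eventually.of_forall fun ω => sq_nonneg _)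
          (integrable_const _) (hXB.mono fun ω h => ?_)
        exact sq_le_sq.2 (by
          rw [abs_of_nonneg (by linarith : 0 ≤ B)]
          exact (norm_le_pi_norm (X ω) j).trans h)
      simpa using h3
    nlinarith
  have hHM : H M ≤ α := (gaussExceed_le_card_mul_exp hsq hM).trans hMα
  have hsqc : ∀ j, (c / 2) ^ 2 ≤ ∑ i, multCoeff X ω₀ j i ^ 2 := by
    intro j
    have h1 := (hω₀.sum_sq_multCoeff_mem j).1
    have h2 := hXc j
    nlinarith
  -- comparison of a Gaussian vector with the reference vector
  have hcomp : ∀ a : J → Fin n → ℝ,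
      (∀ j k, |∑ i, multCoeff X ω₀ j i * multCoeff X ω₀ k i - ∑ i, a j i * a k i| ≤ 3 * Δ) →
      ∀ z, H (z + 2 * δ) ≤ gaussExceed a z + e₁ := by
    intro a ha z
    obtain ⟨g, hg, hg01, hg1, hg0, hgT⟩ := hsmooth J δ (z + δ) hδ
    have h1 : H (z + 2 * δ) ≤ ∫ ξ, g (fun j => ∑ i, multCoeff X ω₀ j i * ξ i) ∂γ := by
      refine measureReal_le_integral_of_eq_one (hg.comp (by fun_prop)) (fun ξ => hg01 _) ?_
      rintro ξ ⟨j, hj⟩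
      exact hg1 _ ⟨j, by linarith⟩
    have h2 : ∫ ξ, g (fun j => ∑ i, a j i * ξ i) ∂γ ≤ gaussExceed a z := by
      refine integral_le_measureReal_of_eq_zero (fun ξ => hg01 _)
        (measurableSet_exists_lt_sum a z) ?_
      intro ξ hξ
      replace hξ : ¬ ∃ j, z < ∑ i, a j i * ξ i := hξ
      push Not at hξ
      exact hg0 _ fun j => by linarith [hξ j]
    have h3 := abs_integral_linear_gaussian_sub_le (multCoeff X ω₀) a hg
      (fun w => abs_le.2 ⟨by linarith [(hg01 w).1], (hg01 w).2⟩) (by positivity) hgT ha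
    have h4 : K₁ * L / δ ^ 2 * (3 * Δ) = e₁ := by rw [he₁]; ring
    rw [h4] at h3
    linarith [(abs_le.1 h3).2]
  -- comparison of the empirical process with the reference vector
  have hclt : ∀ z, Pn.real {ω | ∃ j, z + 2 * δ < (∑ i, X (ω i) j) / Real.sqrt n}
      ≤ H z + e₁ + Pn.real {ω | ¬ IsGoodSample κ X Δ ω}
        + C₀ * K₁ * (L ^ 2 * B ^ 3 / (δ ^ 3 * Real.sqrt n)) := by
    intro z
    obtain ⟨g, hg, hg01, hg1, hg0, hgT⟩ := hsmooth J δ (z + δ) hδ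
    have hXj : ∀ j, Measurable fun ω => X ω j := fun j => (measurable_pi_apply j).comp hX
    have hgabs : ∀ w, |g w| ≤ 1 := fun w => abs_le.2 ⟨by linarith [(hg01 w).1], (hg01 w).2⟩
    have h1 : Pn.real {ω | ∃ j, z + 2 * δ < (∑ i, X (ω i) j) / Real.sqrt n}
        ≤ ∫ ω, g (fun j => (∑ i, X (ω i) j) / Real.sqrt n) ∂Pn := by
      refine measureReal_le_integral_of_eq_one (hg.comp (by fun_prop)) (fun ξ => hg01 _) ?_
      rintro ξ ⟨j, hj⟩
      exact hg1 _ ⟨j, by linarith⟩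
    have h2 := hCLT κ hX (by linarith) hXB hX0 hg hgabs (by positivity) hgT hn
    have hF0 : ∀ ω : Fin n → Ω,
        0 ≤ ∫ ξ, g (fun j => ∑ i, (X (ω i) j / Real.sqrt n) * ξ i) ∂γ :=
      fun ω => integral_nonneg fun ξ => (hg01 _).1
    have hF1 : ∀ ω : Fin n → Ω,
        ∫ ξ, g (fun j => ∑ i, (X (ω i) j / Real.sqrt n) * ξ i) ∂γ ≤ 1 := fun ω =>
      (integral_le_measureReal_of_eq_zero (fun ξ => hg01 _) MeasurableSet.univ
        (by simp)).trans (by simp)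
    have hFgood : ∀ ω : Fin n → Ω, IsGoodSample κ X Δ ω →
        ∫ ξ, g (fun j => ∑ i, (X (ω i) j / Real.sqrt n) * ξ i) ∂γ ≤ H z + e₁ := by
      intro ω hω
      have h3 := abs_integral_linear_gaussian_sub_le (multCoeff X ω) (multCoeff X ω₀) hg
        hgabs (by positivity) hgT (hω.abs_cov_sub_le hω₀)
      have h4 : K₁ * L / δ ^ 2 * (3 * Δ) = e₁ := by rw [he₁]; ring
      rw [h4] at h3
      have h5 : ∫ ξ, g (fun j => ∑ i, multCoeff X ω₀ j i * ξ i) ∂γ ≤ H z := by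
        refine integral_le_measureReal_of_eq_zero (fun ξ => hg01 _)
          (measurableSet_exists_lt_sum (multCoeff X ω₀) z) ?_
        intro ξ hξ
        replace hξ : ¬ ∃ j, z < ∑ i, multCoeff X ω₀ j i * ξ i := hξ
        push Not at hξ
        exact hg0 _ fun j => by linarith [hξ j]
      have h6 := (abs_le.1 h3).2
      change ∫ ξ, g (fun j => ∑ i, multCoeff X ω j i * ξ i) ∂γ ≤ _
      linarith
    have hHe : 0 ≤ H z + e₁ := add_nonneg measureReal_nonneg (by positivity)
    have hGm := measurableSet_isGoodSample κ hX Δ n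
    have h7 : ∫ ω, ∫ ξ, g (fun j => ∑ i, (X (ω i) j / Real.sqrt n) * ξ i) ∂γ ∂Pn
        ≤ H z + e₁ + Pn.real {ω | ¬ IsGoodSample κ X Δ ω} := by
      have hind : Integrable
          (({ω : Fin n → Ω | IsGoodSample κ X Δ ω}ᶜ).indicator (1 : (Fin n → Ω) → ℝ)) Pn :=
        (integrable_const (1 : ℝ)).indicator hGm.compl
      have h8 : ∫ ω, ((H z + e₁)
          + ({ω : Fin n → Ω | IsGoodSample κ X Δ ω}ᶜ).indicator (1 : (Fin n → Ω) → ℝ) ω) ∂Pn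
          = H z + e₁ + Pn.real {ω | ¬ IsGoodSample κ X Δ ω} := by
        rw [integral_add (integrable_const _) hind, integral_indicator_one hGm.compl]
        simp
        rfl
      rw [← h8]
      refine integral_mono_of_nonneg (Eventually.of_forall hF0) ((integrable_const _).add hind)
        (Eventually.of_forall fun ω => ?_)
      by_cases hω : IsGoodSample κ X Δ ω
      · simpa [hω] using hFgood ω hω
      · simp only [mem_compl_iff, mem_ofPred_eq, hω, not_false_eq_true, indicator_of_mem,
          Pi.one_apply]
        linarith [hF1 ω]
    have h9 := (abs_le.1 h2).2
    have h10 : C₀ * (K₁ * L ^ 2 / δ ^ 3) * B ^ 3 / Real.sqrt n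
        = C₀ * K₁ * (L ^ 2 * B ^ 3 / (δ ^ 3 * Real.sqrt n)) := by ring
    rw [← hPn, ← hγ, h10] at h9
    linarith
  -- the threshold
  have he₁0 : 0 ≤ e₁ := by positivity
  set A := {z : ℝ | 0 ≤ z ∧ H z ≤ α + e₁} with hA
  have hAM : M ∈ A := ⟨hM, by linarith⟩
  have hAb : BddBelow A := ⟨0, fun z hz => hz.1⟩
  obtain ⟨ζ', hζ'A, hζ'⟩ := exists_lt_of_csInf_lt ⟨M, hAM⟩ (lt_add_of_pos_right (sInf A) hδ)
  have hζ'M : ζ' ≤ M + δ := by linarith [csInf_le hAb hAM]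
  refine ⟨ζ' - 3 * δ, ?_, ?_⟩
  · intro ω hω z hz hzα
    have h1 := hcomp _ (hω₀.abs_cov_centered_sub_le hn hΔ1 hω) z
    have h2 : z + 2 * δ ∈ A := ⟨by positivity, by linarith⟩
    linarith [csInf_le hAb h2]
  · have h1 := hclt (ζ' - 6 * δ)
    have h2 := gaussExceed_le_add_anticoncentration (half_pos hc) hsqc (x := ζ' - 6 * δ)
      (δ := 6 * δ) (by positivity)
    have h3 : ζ' - 6 * δ + 6 * δ = ζ' := by ring
    have h4 : ζ' - 6 * δ + 2 * δ = ζ' - 3 * δ - δ := by ring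
    rw [h3, ← hH] at h2
    rw [h4] at h1
    have h5 : H ζ' ≤ α + e₁ := hζ'A.2
    have h6 : |ζ' - 6 * δ| ≤ M + 7 * δ := by
      have := hζ'A.1
      rw [abs_le]; constructor <;> linarith
    have h7 : Real.exp (3 / 2) * (6 * δ / (c / 2)) * (1 + |ζ' - 6 * δ| / (c / 2) + 6 * δ / (c / 2))
        ≤ Real.exp (3 / 2) * 12 * 26 * (δ / c * (1 + (M + δ) / c)) := by
      have h8 : 1 + |ζ' - 6 * δ| / (c / 2) + 6 * δ / (c / 2) ≤ 26 * (1 + (M + δ) / c) := by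
        have h9 : |ζ' - 6 * δ| / (c / 2) ≤ (M + 7 * δ) / (c / 2) := by gcongr
        have h10 : (M + 7 * δ) / (c / 2) + 6 * δ / (c / 2) ≤ 26 * ((M + δ) / c) := by
          rw [← add_div, div_div_eq_mul_div, mul_div_assoc', div_le_div_iff_of_pos_right hc]
          linarith
        linarith
      calc _ ≤ Real.exp (3 / 2) * (6 * δ / (c / 2)) * (26 * (1 + (M + δ) / c)) := by gcongr
        _ = _ := by field_simp; ring
    have hp1 : 0 ≤ L * Δ / δ ^ 2 := by positivity
    have hp2 : 0 ≤ L ^ 2 * B ^ 3 / (δ ^ 3 * Real.sqrt n) := by positivity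
    have hp3 : 0 ≤ δ / c * (1 + (M + δ) / c) := by positivity
    have hE : 0 < Real.exp (3 / 2) := Real.exp_pos _
    have hCK : 0 < C₀ * K₁ := by positivity
    set E := Real.exp (3 / 2)
    set CK := C₀ * K₁
    set p1 := L * Δ / δ ^ 2
    set p2 := L ^ 2 * B ^ 3 / (δ ^ 3 * Real.sqrt n)
    set p3 := δ / c * (1 + (M + δ) / c)
    have : (6 * K₁ + CK + E * 12 * 26) * (p1 + p2 + p3)
        = 6 * K₁ * p1 + CK * p2 + E * 12 * 26 * p3
          + (6 * K₁ * (p2 + p3) + CK * (p1 + p3) + E * 12 * 26 * (p1 + p2)) := by ring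
    have hrest : 0 ≤ 6 * K₁ * (p2 + p3) + CK * (p1 + p3) + E * 12 * 26 * (p1 + p2) := by
      positivity
    linarith

lemma isClosed_isLandscapeType (T : ℝ) : IsClosed {f : C(ℝ, ℝ) | IsLandscapeType T f} := by
  have h : {f : C(ℝ, ℝ) | IsLandscapeType T f} =
      (⋂ x, ⋂ y, {f : C(ℝ, ℝ) | dist (f x) (f y) ≤ dist x y}) ∩
        ((⋂ t, {f : C(ℝ, ℝ) | 0 ≤ f t ∧ f t ≤ T / 2}) ∩
          ⋂ t, ⋂ (_ : t ∉ Icc (0 : ℝ) T), {f : C(ℝ, ℝ) | f t = 0}) := by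
    ext f
    simp [IsLandscapeType, lipschitzWith_iff_dist_le_mul]
  rw [h]
  have he : ∀ t : ℝ, Continuous fun f : C(ℝ, ℝ) => f t := fun t => continuous_eval_const t
  refine IsClosed.inter ?_ (IsClosed.inter ?_ ?_)
  · exact isClosed_iInter fun x => isClosed_iInter fun y =>
      isClosed_le ((he x).dist (he y)) continuous_const
  · exact isClosed_iInter fun t => (isClosed_le continuous_const (he t)).inter
      (isClosed_le (he t) continuous_const)
  · exact isClosed_iInter fun t => isClosed_iInter fun _ => isClosed_eq (he t) continuous_const

lemma measurable_continuousMap_eval (t : ℝ) : Measurable fun f : C(ℝ, ℝ) => f t :=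
  (continuous_eval_const t).measurable

section Landscape

variable {T : ℝ} {P : Measure C(ℝ, ℝ)} [IsProbabilityMeasure P]

lemma ae_isLandscapeType (hP : P {f | IsLandscapeType T f} = 1) :
    ∀ᵐ f : C(ℝ, ℝ) ∂P, IsLandscapeType T f :=
  (mem_ae_iff_prob_eq_one (isClosed_isLandscapeType T).measurableSet).2 hP

lemma integrable_eval (hP : P {f | IsLandscapeType T f} = 1) (t : ℝ) :
    Integrable (fun f : C(ℝ, ℝ) => f t) P :=
  Integrable.of_bound (measurable_continuousMap_eval t).aestronglyMeasurable (T / 2)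
    ((ae_isLandscapeType hP).mono fun f hf => by
      rw [Real.norm_eq_abs, abs_of_nonneg (hf.2.1 t).1]; exact (hf.2.1 t).2)

lemma integrable_eval_sq (hP : P {f | IsLandscapeType T f} = 1) (t : ℝ) :
    Integrable (fun f : C(ℝ, ℝ) => f t ^ 2) P :=
  Integrable.of_bound ((measurable_continuousMap_eval t).pow_const 2).aestronglyMeasurable
    ((T / 2) ^ 2)
    ((ae_isLandscapeType hP).mono fun f hf => by
      have := hf.2.1 t
      rw [Real.norm_eq_abs, abs_of_nonneg (sq_nonneg _)]
      exact pow_le_pow_left₀ this.1 this.2 2)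

lemma lmean_mem_Icc (hP : P {f | IsLandscapeType T f} = 1) (t : ℝ) :
    lmean P t ∈ Icc 0 (T / 2) := by
  constructor
  · exact integral_nonneg_of_ae ((ae_isLandscapeType hP).mono fun f hf => (hf.2.1 t).1)
  · have h : ∫ f, f t ∂P ≤ ∫ _, T / 2 ∂P := integral_mono_ae (integrable_eval hP t)
      (integrable_const _) ((ae_isLandscapeType hP).mono fun f hf => (hf.2.1 t).2)
    simpa [lmean] using h

lemma abs_lmean_sub_le (hP : P {f | IsLandscapeType T f} = 1) (s t : ℝ) :
    |lmean P s - lmean P t| ≤ |s - t| := by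
  rw [lmean, lmean, ← integral_sub (integrable_eval hP s) (integrable_eval hP t)]
  have h := norm_integral_le_of_norm_le_const (μ := P) (f := fun f : C(ℝ, ℝ) => f s - f t)
    (C := |s - t|) ((ae_isLandscapeType hP).mono fun f hf => by
      simpa [Real.dist_eq] using hf.1.dist_le_mul s t)
  simpa using h

lemma integral_eval_sub_lmean (hP : P {f | IsLandscapeType T f} = 1) (t : ℝ) :
    ∫ f, (f t - lmean P t) ∂P = 0 := by
  rw [integral_sub (integrable_eval hP t) (integrable_const _)]
  simp [lmean]

lemma integral_eval_sub_lmean_sq (hP : P {f | IsLandscapeType T f} = 1) (t : ℝ) :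
    ∫ f, (f t - lmean P t) ^ 2 ∂P = lvar P t := by
  have h : ∀ f : C(ℝ, ℝ), (f t - lmean P t) ^ 2
      = f t ^ 2 - 2 * lmean P t * f t + lmean P t ^ 2 := fun f => by ring
  simp only [h]
  have h1 := (integrable_eval hP t).const_mul (2 * lmean P t)
  have h2 : Integrable (fun f : C(ℝ, ℝ) => f t ^ 2 - 2 * lmean P t * f t) P :=
    (integrable_eval_sq hP t).sub h1
  rw [integral_add h2 (integrable_const _), integral_sub (integrable_eval_sq hP t) h1,
    integral_const_mul]
  simp only [integral_const, probReal_univ, one_smul, lvar, lmean]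
  ring

end Landscape

lemma bddAbove_range_abs_sum (t₁ t₂ : ℝ) {n : ℕ} (l : Fin n → C(ℝ, ℝ)) (ξ : Fin n → ℝ) :
    BddAbove (range fun t : Icc t₁ t₂ =>
      |(∑ i, ξ i * (l i ↑t - empMean n l ↑t)) / Real.sqrt n|) := by
  refine (isCompact_range ?_).bddAbove
  unfold empMean
  fun_prop

lemma exists_mem_bootQuant_set {t₁ t₂ α : ℝ} (hα : 0 < α) {n : ℕ} (l : Fin n → C(ℝ, ℝ)) :
    ∃ z : ℝ, (Measure.pi fun _ : Fin n => gaussianReal 0 1)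
      {ξ | z < ⨆ t : Icc t₁ t₂, |(∑ i, ξ i * (l i ↑t - empMean n l ↑t)) / Real.sqrt n|}
      ≤ ENNReal.ofReal α := by
  obtain ⟨D, hD⟩ : ∃ D, ∀ i, ∀ t : Icc t₁ t₂, |(l i ↑t - empMean n l ↑t) / Real.sqrt n| ≤ D := by
    have h : ∀ i, ∃ D, ∀ t : Icc t₁ t₂, |(l i ↑t - empMean n l ↑t) / Real.sqrt n| ≤ D := by
      intro i
      have hb : BddAbove (range fun t : Icc t₁ t₂ =>
          |(l i ↑t - empMean n l ↑t) / Real.sqrt n|) := by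
        refine (isCompact_range ?_).bddAbove
        unfold empMean
        fun_prop
      obtain ⟨D, hD⟩ := hb
      exact ⟨D, fun t => hD ⟨t, rfl⟩⟩
    choose D hD using h
    obtain ⟨D', hD'⟩ := (Set.finite_range D).bddAbove
    exact ⟨D', fun i t => (hD i t).trans (hD' ⟨i, rfl⟩)⟩
  have htight := isTightMeasureSet_singleton
    (μ := Measure.pi fun _ : Fin n => gaussianReal 0 1)
  rw [isTightMeasureSet_iff_exists_isCompact_measure_compl_le] at htight
  obtain ⟨S, hS, hSα⟩ := htight (ENNReal.ofReal α) (by simpa using hα)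
  obtain ⟨z, hz⟩ := hS.bddAbove_image (f := fun ξ : Fin n → ℝ => ∑ i, |ξ i| * |D|)
    (by fun_prop)
  refine ⟨z, (measure_mono ?_).trans (hSα _ rfl)⟩
  intro ξ hξ hξS
  replace hξ : z < ⨆ t : Icc t₁ t₂,
    |(∑ i, ξ i * (l i ↑t - empMean n l ↑t)) / Real.sqrt n| := hξ
  have hz' : ∑ i, |ξ i| * |D| ≤ z := hz ⟨ξ, hξS, rfl⟩
  refine absurd hξ (not_lt.2 ((Real.iSup_le (fun t => ?_)
    (Finset.sum_nonneg fun i _ => by positivity)).trans hz'))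
  rw [Finset.sum_div]
  refine (Finset.abs_sum_le_sum_abs _ _).trans (Finset.sum_le_sum fun i _ => ?_)
  rw [mul_div_assoc, abs_mul]
  exact mul_le_mul_of_nonneg_left ((hD i t).trans (le_abs_self D)) (abs_nonneg _)

lemma nonneg_of_mem_bootQuant_set {t₁ t₂ α : ℝ} (hα : α < 1) {n : ℕ} {l : Fin n → C(ℝ, ℝ)} {z : ℝ}
    (hz : (Measure.pi fun _ : Fin n => gaussianReal 0 1)
      {ξ | z < ⨆ t : Icc t₁ t₂, |(∑ i, ξ i * (l i ↑t - empMean n l ↑t)) / Real.sqrt n|}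
      ≤ ENNReal.ofReal α) : 0 ≤ z := by
  by_contra! h
  have : {ξ : Fin n → ℝ |
      z < ⨆ t : Icc t₁ t₂, |(∑ i, ξ i * (l i ↑t - empMean n l ↑t)) / Real.sqrt n|} = univ :=
    eq_univ_of_forall fun ξ => h.trans_le (Real.iSup_nonneg fun t => abs_nonneg _)
  rw [this, measure_univ, ENNReal.one_le_ofReal] at hz
  linarith

/-- The centred process at finitely many points `p`, doubled by signs. -/
def signedProcess (P : Measure C(ℝ, ℝ)) {m : ℕ} (p : Fin m → ℝ) (f : C(ℝ, ℝ))
    (j : Fin m × Bool) : ℝ :=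
  (if j.2 then 1 else -1) * (f (p j.1) - lmean P (p j.1))

lemma measurable_signedProcess (P : Measure C(ℝ, ℝ)) {m : ℕ} (p : Fin m → ℝ) :
    Measurable (signedProcess P p) :=
  measurable_pi_lambda _ fun j =>
    ((measurable_continuousMap_eval (p j.1)).sub_const _).const_mul _

lemma sum_signedProcess (P : Measure C(ℝ, ℝ)) {m n : ℕ} (p : Fin m → ℝ) (l : Fin n → C(ℝ, ℝ))
    (hn : 0 < n) (j : Fin m × Bool) :
    ∑ i, signedProcess P p (l i) j
      = n * ((if j.2 then 1 else -1) * (empMean n l (p j.1) - lmean P (p j.1))) := by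
  have hn' : (n : ℝ) ≠ 0 := by positivity
  simp only [signedProcess, empMean]
  rw [← Finset.mul_sum, Finset.sum_sub_distrib]
  simp only [Finset.sum_const, Finset.card_univ, Fintype.card_fin, nsmul_eq_mul]
  field_simp

lemma gaussExceed_le_of_mem_bootQuant_set (P : Measure C(ℝ, ℝ)) {t₁ t₂ α : ℝ} (hα : 0 ≤ α)
    {m n : ℕ} (hn : 0 < n) {p : Fin m → ℝ} (hp : ∀ k, p k ∈ Icc t₁ t₂) {l : Fin n → C(ℝ, ℝ)}
    {z : ℝ} (hz : (Measure.pi fun _ : Fin n => gaussianReal 0 1)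
      {ξ | z < ⨆ t : Icc t₁ t₂, |(∑ i, ξ i * (l i ↑t - empMean n l ↑t)) / Real.sqrt n|}
      ≤ ENNReal.ofReal α) :
    gaussExceed (multCoeffCentered (signedProcess P p) l) z ≤ α := by
  refine ENNReal.toReal_le_of_le_ofReal hα ((measure_mono ?_).trans hz)
  rintro ξ ⟨j, hj⟩
  have hn' : (n : ℝ) ≠ 0 := by positivity
  have h : ∑ i, multCoeffCentered (signedProcess P p) l j i * ξ i = (if j.2 then 1 else -1) *
      ((∑ i, ξ i * (l i (p j.1) - empMean n l (p j.1))) / Real.sqrt n) := by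
    rw [Finset.sum_div, Finset.mul_sum]
    refine Finset.sum_congr rfl fun i _ => ?_
    rw [multCoeffCentered, sum_signedProcess P p l hn, signedProcess]
    field_simp
    ring
  rw [h] at hj
  refine (hj.trans_le ?_).trans_le (le_ciSup (bddAbove_range_abs_sum t₁ t₂ l ξ) ⟨p j.1, hp j.1⟩)
  split_ifs
  · rw [one_mul]; exact le_abs_self _
  · rw [neg_one_mul]; exact neg_le_abs _

lemma le_bootQuant (P : Measure C(ℝ, ℝ)) {t₁ t₂ α ζ : ℝ} (hα0 : 0 < α) (hα1 : α < 1)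
    {m n : ℕ} (hn : 0 < n) {p : Fin m → ℝ} (hp : ∀ k, p k ∈ Icc t₁ t₂) {l : Fin n → C(ℝ, ℝ)}
    (hζ : ∀ z, 0 ≤ z → gaussExceed (multCoeffCentered (signedProcess P p) l) z ≤ α → ζ ≤ z) :
    ζ ≤ bootQuant t₁ t₂ α n l :=
  le_csInf (exists_mem_bootQuant_set hα0 l) fun z hz =>
    hζ z (nonneg_of_mem_bootQuant_set hα1 hz)
      (gaussExceed_le_of_mem_bootQuant_set P hα0.le hn hp hz)

/-- The equidistant grid of `n + 1` points on `[t₁, t₂]`. -/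
def gridPoint (t₁ t₂ : ℝ) (n : ℕ) (k : Fin (n + 1)) : ℝ := t₁ + (t₂ - t₁) * (k / n)

lemma gridPoint_mem_Icc {t₁ t₂ : ℝ} (h : t₁ ≤ t₂) {n : ℕ} (hn : 0 < n) (k : Fin (n + 1)) :
    gridPoint t₁ t₂ n k ∈ Icc t₁ t₂ := by
  have hn' : (0 : ℝ) < n := by exact_mod_cast hn
  have h1 : (k : ℝ) / n ≤ 1 := by
    rw [div_le_one hn']
    exact_mod_cast Nat.lt_succ_iff.1 k.2
  have h0 : 0 ≤ (k : ℝ) / n := by positivity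
  constructor <;> simp only [gridPoint] <;> nlinarith

lemma exists_gridPoint_near {t₁ t₂ t : ℝ} (h : t₁ < t₂) {n : ℕ} (hn : 0 < n)
    (ht : t ∈ Icc t₁ t₂) : ∃ k, |t - gridPoint t₁ t₂ n k| ≤ (t₂ - t₁) / n := by
  have hn' : (0 : ℝ) < n := by exact_mod_cast hn
  have hd : 0 < t₂ - t₁ := by linarith
  set s := (t - t₁) / (t₂ - t₁) * n with hs
  have hs0 : 0 ≤ s := mul_nonneg (div_nonneg (by linarith [ht.1]) hd.le) hn'.le
  have hsn : s ≤ n := by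
    have : (t - t₁) / (t₂ - t₁) ≤ 1 := by rw [div_le_one hd]; linarith [ht.2]
    nlinarith
  have hk : ⌊s⌋₊ < n + 1 := Nat.lt_succ_of_le (Nat.floor_le_of_le hsn)
  refine ⟨⟨⌊s⌋₊, hk⟩, ?_⟩
  have e : t - gridPoint t₁ t₂ n ⟨⌊s⌋₊, hk⟩ = (t₂ - t₁) / n * (s - ⌊s⌋₊) := by
    simp only [gridPoint, hs]
    field_simp
    ring
  have h1 := Nat.floor_le hs0
  have h2 := Nat.lt_floor_add_one s
  rw [e, abs_of_nonneg (mul_nonneg (by positivity) (by linarith))]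
  exact mul_le_of_le_one_right (by positivity) (by linarith)

lemma abs_empMean_sub_le {T : ℝ} {n : ℕ} {l : Fin n → C(ℝ, ℝ)} (hn : 0 < n)
    (hl : ∀ i, IsLandscapeType T (l i)) (s t : ℝ) :
    |empMean n l s - empMean n l t| ≤ |s - t| := by
  have hn' : (0 : ℝ) < n := by exact_mod_cast hn
  rw [empMean, empMean, ← sub_div, ← Finset.sum_sub_distrib, abs_div, abs_of_pos hn',
    div_le_iff₀ hn']
  refine (Finset.abs_sum_le_sum_abs _ _).trans ((Finset.sum_le_sum fun i _ => ?_).trans_eq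
    (b := ∑ _ : Fin n, |s - t|) ?_)
  · simpa [Real.dist_eq] using (hl i).1.dist_le_mul s t
  · simp [mul_comm]

/-- If the empirical process stays below `ζ - δ` on the grid and the bootstrap quantile is at
least `ζ`, the confidence band covers the mean function. -/
lemma band_covers {T : ℝ} {P : Measure C(ℝ, ℝ)} [IsProbabilityMeasure P]
    (hP : P {f | IsLandscapeType T f} = 1) {t₁ t₂ : ℝ} (h₁₂ : t₁ < t₂) (hT : t₂ - t₁ ≤ T) {n : ℕ}
    (hn : 0 < n) {l : Fin n → C(ℝ, ℝ)} (hl : ∀ i, IsLandscapeType T (l i)) {ζ δ Z : ℝ}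
    (hδ : 2 * T / Real.sqrt n ≤ δ) (hZ : ζ ≤ Z)
    (hG : ∀ j, (∑ i, signedProcess P (gridPoint t₁ t₂ n) (l i) j) / Real.sqrt n ≤ ζ - δ)
    {t : ℝ} (ht : t ∈ Icc t₁ t₂) :
    empMean n l t - Z / Real.sqrt n ≤ lmean P t ∧ lmean P t ≤ empMean n l t + Z / Real.sqrt n := by
  have hn' : (0 : ℝ) < n := by exact_mod_cast hn
  set r := Real.sqrt n with hr
  have hr0 : 0 < r := Real.sqrt_pos.2 hn'
  have hrr : r * r = n := Real.mul_self_sqrt hn'.le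
  obtain ⟨k, hk⟩ := exists_gridPoint_near h₁₂ hn ht
  set s := gridPoint t₁ t₂ n k
  have hk' : |t - s| ≤ T / n := hk.trans (by gcongr)
  have h1 := abs_le.1 ((abs_empMean_sub_le hn hl t s).trans hk')
  have h2 := abs_le.1 ((abs_lmean_sub_le hP t s).trans hk')
  have h3 := hG (k, true)
  have h4 := hG (k, false)
  rw [sum_signedProcess P _ l hn] at h3 h4
  simp only [if_true, Bool.false_eq_true, if_false] at h3 h4
  rw [← hrr, div_le_iff₀ hr0] at h3 h4
  have h3' : empMean n l s - lmean P s ≤ (ζ - δ) / r := by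
    rw [le_div_iff₀ hr0]; nlinarith
  have h4' : -(empMean n l s - lmean P s) ≤ (ζ - δ) / r := by
    rw [le_div_iff₀ hr0]; nlinarith
  have h5 : (ζ - δ) / r + 2 * (T / n) ≤ Z / r := by
    have : 2 * (T / n) = (2 * T / r) / r := by rw [← hrr]; field_simp
    rw [this, ← add_div]
    gcongr
    linarith
  constructor <;> linarith

lemma ae_pi_isLandscapeType {T : ℝ} {P : Measure C(ℝ, ℝ)} [IsProbabilityMeasure P]
    (hP : P {f | IsLandscapeType T f} = 1) (n : ℕ) :
    ∀ᵐ l ∂(Measure.pi fun _ : Fin n => P), ∀ i, IsLandscapeType T (l i) :=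
  ae_all_iff.2 fun i => (measurePreserving_eval (fun _ : Fin n => P) i).quasiMeasurePreserving.ae
    (ae_isLandscapeType hP)

lemma card_fin_succ_prod_bool (n : ℕ) : (Fintype.card (Fin (n + 1) × Bool) : ℝ) = 2 * (n + 1) := by
  simp only [Fintype.card_prod, Fintype.card_fin, Fintype.card_bool]
  push_cast
  ring

/-- A nonasymptotic coverage bound for the bootstrap band. -/
lemma exists_band_coverage_bound : ∃ K > (0 : ℝ), ∀ {T : ℝ} (_ : 0 < T)
    {P : Measure C(ℝ, ℝ)} [IsProbabilityMeasure P] (_ : P {f | IsLandscapeType T f} = 1)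
    {t₁ t₂ c : ℝ} (_ : t₁ < t₂) (_ : t₂ - t₁ ≤ T) (_ : 0 < c)
    (_ : ∀ t ∈ Icc t₁ t₂, c ≤ lsd P t) {α : ℝ} (_ : 0 < α) (_ : α < 1) {n : ℕ} (_ : 0 < n)
    {δ Δ M β : ℝ} (_ : 0 < δ) (_ : 2 * T / Real.sqrt n ≤ δ)
    (_ : 0 ≤ Δ) (_ : Δ ≤ 1) (_ : Δ ≤ 3 / 4 * c ^ 2) (_ : 0 ≤ M)
    (_ : 2 * (n + 1) * Real.exp (-M ^ 2 / (2 * (2 * (T + 1)) ^ 2)) ≤ α) (_ : β < 1)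
    (_ : ((2 * (n + 1)) ^ 2 + 2 * (n + 1))
      * (2 * Real.exp (-(n * Δ ^ 2) / (2 * ((T + 1) ^ 2) ^ 2))) ≤ β),
    ENNReal.ofReal (1 - α - 2 * β - K * ((1 + Real.log (2 * (n + 1))) * Δ / δ ^ 2
        + (1 + Real.log (2 * (n + 1))) ^ 2 * (T + 1) ^ 3 / (δ ^ 3 * Real.sqrt n)
        + δ / c * (1 + (M + δ) / c)))
      ≤ (Measure.pi fun _ : Fin n => P)
        {l | ∀ t ∈ Icc t₁ t₂,
            empMean n l t - bootQuant t₁ t₂ α n l / Real.sqrt n ≤ lmean P t ∧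
            lmean P t ≤ empMean n l t + bootQuant t₁ t₂ α n l / Real.sqrt n} := by
  obtain ⟨K, hK, hmain⟩ := exists_threshold_exceed_le
  refine ⟨K, hK, ?_⟩
  intro T hT P _ hP t₁ t₂ c h₁₂ htT hc hσ α hα0 hα1 n hn δ Δ M β hδ hδT hΔ hΔ1 hΔc hM hMα hβ1 hβ
  set X := signedProcess P (gridPoint t₁ t₂ n) with hXdef
  have hX : Measurable X := measurable_signedProcess P _
  have hXB : ∀ᵐ f ∂P, ‖X f‖ ≤ T + 1 := by
    filter_upwards [ae_isLandscapeType hP] with f hf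
    refine (pi_norm_le_iff_of_nonneg (by linarith)).2 fun j => ?_
    have h1 := hf.2.1 (gridPoint t₁ t₂ n j.1)
    have h2 := lmean_mem_Icc hP (gridPoint t₁ t₂ n j.1)
    rw [hXdef, signedProcess, Real.norm_eq_abs, abs_mul,
      show |(if j.2 then 1 else -1 : ℝ)| = 1 by split_ifs <;> simp, one_mul, abs_le]
    constructor <;> linarith [h1.1, h1.2, h2.1, h2.2]
  have hX0 : ∀ j, ∫ f, X f j ∂P = 0 := fun j => by
    simp only [hXdef, signedProcess]
    rw [integral_const_mul, integral_eval_sub_lmean hP, mul_zero]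
  have hXc : ∀ j, c ^ 2 ≤ ∫ f, X f j ^ 2 ∂P := fun j => by
    have h1 : ∀ f, X f j ^ 2
        = (f (gridPoint t₁ t₂ n j.1) - lmean P (gridPoint t₁ t₂ n j.1)) ^ 2 := fun f => by
      rw [hXdef, signedProcess, mul_pow,
        show (if j.2 then 1 else -1 : ℝ) ^ 2 = 1 by split_ifs <;> simp, one_mul]
    simp only [h1]
    rw [integral_eval_sub_lmean_sq hP]
    have h2 := hσ _ (gridPoint_mem_Icc h₁₂.le hn j.1)
    rw [lsd] at h2
    exact (Real.le_sqrt' hc).1 h2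
  set Pn := Measure.pi fun _ : Fin n => P
  have hbad : Pn.real {ω | ¬ IsGoodSample P X Δ ω} ≤ β := by
    have h := measureReal_not_isGoodSample_le P hX (by linarith) hXB hX0 hn hΔ
    rw [card_fin_succ_prod_bool] at h
    exact h.trans hβ
  obtain ⟨ζ, hζ, hex⟩ := hmain P (α := α) hX (by linarith) hXB hX0 hc hXc hn hδ hΔ hΔ1 hΔc hM
    (by rwa [card_fin_succ_prod_bool]) (hbad.trans_lt hβ1)
  rw [card_fin_succ_prod_bool] at hex
  have hland : Pn.real {l | ¬ ∀ i, IsLandscapeType T (l i)} = 0 := by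
    rw [measureReal_def, ae_iff.1 (ae_pi_isLandscapeType hP n), ENNReal.toReal_zero]
  set cover := {l : Fin n → C(ℝ, ℝ) | ∀ t ∈ Icc t₁ t₂,
            empMean n l t - bootQuant t₁ t₂ α n l / Real.sqrt n ≤ lmean P t ∧
            lmean P t ≤ empMean n l t + bootQuant t₁ t₂ α n l / Real.sqrt n}
  have hsub : (univ : Set (Fin n → C(ℝ, ℝ))) ⊆ cover ∪
      ({l | ∃ j, ζ - δ < (∑ i, X (l i) j) / Real.sqrt n} ∪
        ({l | ¬ IsGoodSample P X Δ l} ∪ {l | ¬ ∀ i, IsLandscapeType T (l i)})) := by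
    intro l _
    by_cases hl : ∀ i, IsLandscapeType T (l i)
    swap
    · exact Or.inr (Or.inr (Or.inr hl))
    by_cases hg : IsGoodSample P X Δ l
    swap
    · exact Or.inr (Or.inr (Or.inl hg))
    by_cases he : ∃ j, ζ - δ < (∑ i, X (l i) j) / Real.sqrt n
    · exact Or.inr (Or.inl he)
    · push Not at he
      exact Or.inl fun t ht => band_covers hP h₁₂ htT hn hl hδT
        (le_bootQuant P hα0 hα1 hn (gridPoint_mem_Icc h₁₂.le hn) (hζ l hg)) he ht
  have h1 : Pn.real univ ≤ _ := measureReal_mono hsub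
  rw [probReal_univ] at h1
  have h2 := measureReal_union_le (μ := Pn) cover
    ({l | ∃ j, ζ - δ < (∑ i, X (l i) j) / Real.sqrt n} ∪
        ({l | ¬ IsGoodSample P X Δ l} ∪ {l | ¬ ∀ i, IsLandscapeType T (l i)}))
  have h3 := measureReal_union_le (μ := Pn)
    {l | ∃ j, ζ - δ < (∑ i, X (l i) j) / Real.sqrt n}
    ({l | ¬ IsGoodSample P X Δ l} ∪ {l | ¬ ∀ i, IsLandscapeType T (l i)})
  have h4 := measureReal_union_le (μ := Pn)
    {l | ¬ IsGoodSample P X Δ l} {l | ¬ ∀ i, IsLandscapeType T (l i)}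
  refine ENNReal.ofReal_le_of_le_toReal ?_
  change _ ≤ Pn.real cover
  linarith

/-- The error terms of the coverage bound, in terms of `u = n^{1/8}` and `v = (log n)^{1/8}`. -/
lemma coverage_error_le {u v B c L : ℝ} (hu : 1 ≤ u) (hv : 1 ≤ v)
    (hB : 0 < B) (hc : 0 < c) (hL0 : 0 ≤ L) (hL : L ≤ 3 * v ^ 8) :
    L * (3 * B ^ 2 * v ^ 4 / u ^ 4) / (v ^ 3 / u) ^ 2
        + L ^ 2 * B ^ 3 / ((v ^ 3 / u) ^ 3 * u ^ 4)
        + v ^ 3 / u / c * (1 + (4 * B * v ^ 4 + v ^ 3 / u) / c)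
      ≤ (9 * B ^ 2 + 9 * B ^ 3 + (1 + (4 * B + 1) / c) / c) * (v ^ 7 / u) := by
  have hu0 : 0 < u := by linarith
  have hv0 : 0 < v := by linarith
  have h1 : L * (3 * B ^ 2 * v ^ 4 / u ^ 4) / (v ^ 3 / u) ^ 2 ≤ 9 * B ^ 2 * (v ^ 7 / u) := by
    calc _ ≤ (3 * v ^ 8) * (3 * B ^ 2 * v ^ 4 / u ^ 4) / (v ^ 3 / u) ^ 2 := by gcongr
      _ = 9 * B ^ 2 * (v ^ 6 * 1 / (u * u)) := by field_simp; ring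
      _ ≤ 9 * B ^ 2 * (v ^ 6 * v / (u * 1)) := by gcongr
      _ = _ := by ring
  have h2 : L ^ 2 * B ^ 3 / ((v ^ 3 / u) ^ 3 * u ^ 4) ≤ 9 * B ^ 3 * (v ^ 7 / u) := by
    calc _ ≤ (3 * v ^ 8) ^ 2 * B ^ 3 / ((v ^ 3 / u) ^ 3 * u ^ 4) := by gcongr
      _ = _ := by field_simp; ring
  have h3 : v ^ 3 / u / c * (1 + (4 * B * v ^ 4 + v ^ 3 / u) / c)
      ≤ (1 + (4 * B + 1) / c) / c * (v ^ 7 / u) := by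
    have h4 : 1 ≤ v ^ 4 := one_le_pow₀ hv
    have h5 : v ^ 3 / u ≤ v ^ 4 := by
      rw [div_le_iff₀ hu0]
      calc v ^ 3 = v ^ 3 * 1 := by ring
        _ ≤ v ^ 4 * u := by gcongr; norm_num
    calc _ ≤ v ^ 3 / u / c * (v ^ 4 + (4 * B * v ^ 4 + v ^ 4) / c) := by gcongr
      _ = _ := by field_simp
  linarith

lemma card_sq_mul_inv_cube_le {x : ℝ} (hx : 1 ≤ x) :
    ((2 * (x + 1)) ^ 2 + 2 * (x + 1)) * (2 * (1 / x ^ 3)) ≤ 40 / x := by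
  have hx0 : 0 < x := by linarith
  calc _ ≤ 20 * x ^ 2 * (2 * (1 / x ^ 3)) := by
        gcongr
        nlinarith
    _ = 40 / x := by field_simp; norm_num

/-- **Uniform confidence band: coverage.**  If `P` is concentrated on landscape-type
functions and `σ(t) ≥ c > 0` on `[t₁,t₂] ⊆ [0,T]`, then for every `α ∈ (0,1)` there are
`C > 0` and `N₀` such that for all `n ≥ N₀`,
`Pⁿ(∀ t ∈ [t₁,t₂], λ̄_n(t) − Z̃_α/√n ≤ μ(t) ≤ λ̄_n(t) + Z̃_α/√n)
  ≥ 1 − α − C (log n)^{7/8} n^{−1/8}`. -/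
theorem uniform_band_coverage (T : ℝ) (hT : 0 < T)
    (P : Measure C(ℝ, ℝ)) [IsProbabilityMeasure P]
    (hP : P {f | IsLandscapeType T f} = 1)
    (t₁ t₂ c : ℝ) (ht₁ : 0 ≤ t₁) (h₁₂ : t₁ < t₂) (ht₂ : t₂ ≤ T) (hc : 0 < c)
    (hσ : ∀ t ∈ Icc t₁ t₂, c ≤ lsd P t)
    (α : ℝ) (hα0 : 0 < α) (hα1 : α < 1) :
    ∃ C > (0 : ℝ), ∃ N₀ : ℕ, ∀ n ≥ N₀,
      ENNReal.ofReal (1 - α - C * Real.log n ^ ((7 : ℝ) / 8) / (n : ℝ) ^ ((1 : ℝ) / 8))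
        ≤ (Measure.pi fun _ : Fin n => P)
            {l | ∀ t ∈ Icc t₁ t₂,
                empMean n l t - bootQuant t₁ t₂ α n l / Real.sqrt n ≤ lmean P t ∧
                lmean P t ≤ empMean n l t + bootQuant t₁ t₂ α n l / Real.sqrt n} := by
  obtain ⟨K, hK, hbound⟩ := exists_band_coverage_bound
  set B := T + 1 with hB
  have hB0 : 0 < B := by linarith
  have htT : t₂ - t₁ ≤ T := by linarith
  set D := 9 * B ^ 2 + 9 * B ^ 3 + (1 + (4 * B + 1) / c) / c with hD
  have hD0 : 0 < D := by positivity
  refine ⟨80 + K * D, by positivity, ?_⟩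
  obtain ⟨ε, hε0, hε⟩ : ∃ ε > 0, 3 * B ^ 2 * ε ≤ 1 ∧ 3 * B ^ 2 * ε ≤ 3 / 4 * c ^ 2 := by
    refine ⟨min 1 (3 / 4 * c ^ 2) / (3 * B ^ 2), by positivity, ?_, ?_⟩ <;>
      rw [mul_div_cancel₀ _ (by positivity)]
    · exact min_le_left _ _
    · exact min_le_right _ _
  have hev1 : ∀ᶠ n : ℕ in atTop, Real.log n / n ≤ ε ^ 2 := by
    have h : Tendsto (fun x : ℝ => Real.log x / x) atTop (nhds 0) := by
      simpa using Real.tendsto_pow_log_div_mul_add_atTop 1 0 1 one_ne_zero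
    exact (h.comp tendsto_natCast_atTop_atTop).eventually_le_const (by positivity)
  have hev2 : ∀ᶠ n : ℕ in atTop, 2 * T ≤ (n : ℝ) ^ ((1 : ℝ) / 8) :=
    ((tendsto_rpow_atTop (by norm_num : (0 : ℝ) < 1 / 8)).comp
      tendsto_natCast_atTop_atTop).eventually_ge_atTop _
  have hev3 : ∀ᶠ n : ℕ in atTop, 4 / α + 41 ≤ (n : ℝ) :=
    tendsto_natCast_atTop_atTop.eventually_ge_atTop _
  obtain ⟨N₀, hN₀⟩ := eventually_atTop.1 (hev1.and (hev2.and hev3))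
  refine ⟨N₀, fun n hn => ?_⟩
  obtain ⟨hn1, hn2, hn3⟩ := hN₀ n hn
  have hα4 : 0 < 4 / α := by positivity
  have hn41 : (41 : ℝ) ≤ n := by linarith
  have hn0 : (0 : ℝ) < n := by linarith
  have hnN : 0 < n := by exact_mod_cast hn0
  have hlog1 : 1 ≤ Real.log n := by
    rw [Real.le_log_iff_exp_le hn0]
    linarith [Real.exp_one_lt_d9]
  set u := (n : ℝ) ^ ((1 : ℝ) / 8) with hu
  set v := Real.log n ^ ((1 : ℝ) / 8) with hv
  have hu1 : 1 ≤ u := Real.one_le_rpow (by linarith) (by norm_num)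
  have hv1 : 1 ≤ v := Real.one_le_rpow hlog1 (by norm_num)
  have hu0 : 0 < u := by linarith
  have hv0 : 0 < v := by linarith
  have hu8 : u ^ 8 = n := by
    rw [hu, ← Real.rpow_natCast, ← Real.rpow_mul hn0.le]; norm_num
  have hv8 : v ^ 8 = Real.log n := by
    rw [hv, ← Real.rpow_natCast, ← Real.rpow_mul (by linarith)]; norm_num
  have hv7 : Real.log n ^ ((7 : ℝ) / 8) = v ^ 7 := by
    rw [hv, ← Real.rpow_natCast, ← Real.rpow_mul (by linarith)]; norm_num
  have hsqrt : Real.sqrt n = u ^ 4 := by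
    rw [← hu8, show u ^ 8 = (u ^ 4) ^ 2 by ring, Real.sqrt_sq (by positivity)]
  have hratio : v ^ 4 / u ^ 4 ≤ ε := by
    refine (pow_le_pow_iff_left₀ (by positivity) hε0.le two_ne_zero).1 ?_
    rwa [div_pow, ← pow_mul, ← pow_mul, hu8, hv8]
  have hΔ : 3 * B ^ 2 * v ^ 4 / u ^ 4 ≤ 3 * B ^ 2 * ε := by
    rw [mul_div_assoc]; gcongr
  have hexp : ∀ k : ℕ, Real.exp (-(k * v ^ 8)) = 1 / (n : ℝ) ^ k := by
    intro k
    rw [hv8, Real.exp_neg, Real.exp_nat_mul, Real.exp_log hn0, one_div]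
  have hL0 : 0 ≤ Real.log (2 * (n + 1)) := Real.log_nonneg (by linarith)
  have hL : 1 + Real.log (2 * ((n : ℝ) + 1)) ≤ 3 * v ^ 8 := by
    have h : Real.log (2 * ((n : ℝ) + 1)) ≤ Real.log ((n : ℝ) ^ 2) :=
      Real.log_le_log (by positivity) (by nlinarith)
    rw [Real.log_pow] at h
    push_cast at h
    rw [hv8]
    linarith
  have hcov := hbound hT hP h₁₂ htT hc hσ hα0 hα1 hnN (δ := v ^ 3 / u)
    (Δ := 3 * B ^ 2 * v ^ 4 / u ^ 4) (M := 4 * B * v ^ 4) (β := 40 / n) (by positivity)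
    ?_ (by positivity) (hΔ.trans hε.1) (hΔ.trans hε.2) (by positivity) ?_ ?_ ?_
  · refine le_trans (ENNReal.ofReal_le_ofReal ?_) hcov
    have herr := coverage_error_le hu1 hv1 hB0 hc (by linarith) hL
    have hβ : 40 / (n : ℝ) ≤ 40 * (v ^ 7 / u) := by
      rw [div_eq_mul_one_div]
      gcongr
      · exact one_le_pow₀ hv1
      · rw [← hu8]
        exact le_self_pow₀ hu1 (by norm_num)
    rw [hv7, hsqrt]
    have h := mul_le_mul_of_nonneg_left herr hK.le
    rw [mul_div_assoc (80 + K * D), add_mul, mul_assoc K D]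
    linarith
  · rw [hsqrt, div_le_div_iff₀ (by positivity) hu0]
    calc 2 * T * u ≤ u * u := by gcongr
      _ = 1 * u ^ 2 := by ring
      _ ≤ v ^ 3 * u ^ 4 := by
        gcongr
        · exact one_le_pow₀ hv1
        · norm_num
  · have h : -(4 * B * v ^ 4) ^ 2 / (2 * (2 * B) ^ 2) = -((2 : ℕ) * v ^ 8) := by
      field_simp; push_cast; ring
    rw [h, hexp]
    have h4 : 4 / (n : ℝ) ≤ α := by
      rw [div_le_comm₀ hn0 hα0]; linarith
    refine le_trans ?_ h4
    rw [mul_one_div, div_le_div_iff₀ (by positivity) hn0]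
    nlinarith
  · rw [div_lt_one hn0]; linarith
  · have h : Real.exp (-(n * (3 * B ^ 2 * v ^ 4 / u ^ 4) ^ 2) / (2 * (B ^ 2) ^ 2))
        ≤ Real.exp (-((3 : ℕ) * v ^ 8)) := by
      refine Real.exp_le_exp.2 ?_
      rw [← hu8]
      have : -(u ^ 8 * (3 * B ^ 2 * v ^ 4 / u ^ 4) ^ 2) / (2 * (B ^ 2) ^ 2)
          = -(9 / 2 * v ^ 8) := by field_simp; ring
      rw [this]
      push_cast
      have : 0 < v ^ 8 := by positivity
      linarith
    rw [hexp] at h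
    exact (mul_le_mul_of_nonneg_left (mul_le_mul_of_nonneg_left h (by norm_num))
      (by positivity)).trans (card_sq_mul_inv_cube_le (by linarith))
end
end

section
/- (Uniform confidence band, width.) Under the stated assumptions, for every α ∈ (0,1) and every δ ∈ (0,1) there exist M > 0 and N₀ such that for all n ≥ N₀, Pⁿ( Z̃_α(λ_1,…,λ_n) > M ) ≤ δ; equivalently, the width sup_{t ∈ [t₁,t₂]} (u_n(t) − ℓ_n(t)) = 2 Z̃_α(λ_1,…,λ_n)/√n of the bootstrap confidence band is O_P(n^{−1/2}). -/
open MeasureTheory ProbabilityTheory Set Filter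

noncomputable section

/-- The law of `n` i.i.d. standard Gaussian multipliers. -/
abbrev gaussianMultipliers (n : ℕ) : Measure (Fin n → ℝ) :=
  Measure.pi fun _ : Fin n => gaussianReal 0 1

lemma memLp_two_mul_eval_gaussianMultipliers {n : ℕ} (a : ℝ) (i : Fin n) :
    MemLp (fun ξ : Fin n → ℝ => ξ i * a) 2 (gaussianMultipliers n) := by
  have h : MemLp (id : ℝ → ℝ) 2 (gaussianReal 0 1) := memLp_id_gaussianReal 2
  exact (h.comp_measurePreserving
    (measurePreserving_eval (fun _ : Fin n => gaussianReal 0 1) i)).mul_const a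

lemma memLp_two_gaussian_sum {n : ℕ} (a : Fin n → ℝ) :
    MemLp (fun ξ : Fin n → ℝ => ∑ i, ξ i * a i) 2 (gaussianMultipliers n) :=
  memLp_finsetSum _ fun i _ => memLp_two_mul_eval_gaussianMultipliers (a i) i

lemma integral_eval_gaussianMultipliers {n : ℕ} (i : Fin n) :
    ∫ ξ, ξ i ∂(gaussianMultipliers n) = 0 := by
  have := integral_comp_eval (μ := fun _ : Fin n => gaussianReal 0 1) (i := i) (f := (id : ℝ → ℝ))
    aestronglyMeasurable_id
  simpa using this

lemma integral_sq_gaussian_sum {n : ℕ} (a : Fin n → ℝ) :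
    ∫ ξ, (∑ i, ξ i * a i) ^ 2 ∂(gaussianMultipliers n) = ∑ i, a i ^ 2 := by
  have hmean : ∫ ξ, (∑ i, ξ i * a i) ∂(gaussianMultipliers n) = 0 := by
    rw [integral_finsetSum _ fun i _ =>
      (memLp_two_mul_eval_gaussianMultipliers (a i) i).integrable one_le_two]
    exact Finset.sum_eq_zero fun i _ => by
      rw [integral_mul_const, integral_eval_gaussianMultipliers, zero_mul]
  rw [← variance_of_integral_eq_zero (memLp_two_gaussian_sum a).aemeasurable hmean]
  have hsum := variance_sum_pi (μ := fun _ : Fin n => gaussianReal 0 1)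
    (X := fun i x => x * a i) fun i => (memLp_id_gaussianReal 2).mul_const (a i)
  have hcoord : ∀ i, variance (fun x : ℝ => x * a i) (gaussianReal 0 1) = a i ^ 2 := fun i => by
    have hone : variance (fun x : ℝ => x) (gaussianReal 0 1) = 1 := variance_id_gaussianReal
    rw [variance_mul_const, hone, one_mul]
  simp only [hcoord] at hsum
  rw [← hsum]
  congr 1
  ext ξ
  simp

lemma integral_abs_gaussian_sum_le {n : ℕ} (a : Fin n → ℝ) {r : ℝ} (hr : 0 < r)
    (ha : ∑ i, a i ^ 2 ≤ r ^ 2) :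
    ∫ ξ, |∑ i, ξ i * a i| ∂(gaussianMultipliers n) ≤ r := by
  have hL := memLp_two_gaussian_sum a
  calc ∫ ξ, |∑ i, ξ i * a i| ∂(gaussianMultipliers n)
      ≤ ∫ ξ, ((∑ i, ξ i * a i) ^ 2 / (2 * r) + r / 2) ∂(gaussianMultipliers n) := by
        refine integral_mono (hL.integrable one_le_two).abs
          ((hL.integrable_sq.div_const _).add (integrable_const _)) fun ξ => ?_
        have h := sq_nonneg (|∑ i, ξ i * a i| - r)
        rw [sub_sq, sq_abs] at h
        show |∑ i, ξ i * a i| ≤ (∑ i, ξ i * a i) ^ 2 / (2 * r) + r / 2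
        rw [div_add_div _ _ (by positivity) two_ne_zero, le_div_iff₀ (by positivity)]
        nlinarith
    _ = (∑ i, a i ^ 2) / (2 * r) + r / 2 := by
        rw [integral_add (hL.integrable_sq.div_const _) (integrable_const _), integral_div,
          integral_sq_gaussian_sum]
        simp
    _ ≤ r ^ 2 / (2 * r) + r / 2 := by gcongr
    _ = r := by field_simp; ring

/-- The multiplier statistic `n^{-1/2} ∑ ξ_i (x_i - x̄)` of a vector `x`. -/
def multiplierStat {n : ℕ} (x ξ : Fin n → ℝ) : ℝ :=
  (∑ i, ξ i * (x i - (∑ j, x j) / n)) / Real.sqrt n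

lemma multiplierStat_sub {n : ℕ} (x y ξ : Fin n → ℝ) :
    multiplierStat (x - y) ξ = multiplierStat x ξ - multiplierStat y ξ := by
  simp only [multiplierStat, ← sub_div, ← Finset.sum_sub_distrib, Pi.sub_apply]
  congr 1
  refine Finset.sum_congr rfl fun i _ => ?_
  rw [Finset.sum_sub_distrib]
  ring

lemma multiplierStat_eq_sum {n : ℕ} (x ξ : Fin n → ℝ) :
    multiplierStat x ξ = ∑ i, ξ i * ((x i - (∑ j, x j) / n) / Real.sqrt n) := by
  simp only [multiplierStat, Finset.sum_div, mul_div_assoc]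

lemma integrable_abs_multiplierStat {n : ℕ} (x : Fin n → ℝ) :
    Integrable (fun ξ => |multiplierStat x ξ|) (gaussianMultipliers n) := by
  simp only [multiplierStat_eq_sum]
  exact ((memLp_two_gaussian_sum _).integrable one_le_two).abs

lemma integral_abs_multiplierStat_le {n : ℕ} (hn : 1 ≤ n) (x : Fin n → ℝ) {b : ℝ} (hb : 0 < b)
    (hx : ∀ i, |x i| ≤ b) :
    ∫ ξ, |multiplierStat x ξ| ∂(gaussianMultipliers n) ≤ b := by
  have hn' : (0 : ℝ) < n := by exact_mod_cast hn
  simp only [multiplierStat_eq_sum]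
  refine integral_abs_gaussian_sum_le _ hb ?_
  have hx2 : ∑ i, x i ^ 2 ≤ n * b ^ 2 := by
    have := Finset.sum_le_sum (s := Finset.univ) fun i _ => sq_le_sq' (abs_le.1 (hx i)).1
      (abs_le.1 (hx i)).2
    simpa using this
  have hcenter : ∑ i, (x i - (∑ j, x j) / n) ^ 2 = ∑ i, x i ^ 2 - (∑ j, x j) ^ 2 / n := by
    simp only [sub_sq, Finset.sum_add_distrib, Finset.sum_sub_distrib, ← Finset.sum_mul,
      ← Finset.mul_sum, Finset.sum_const, Finset.card_univ, Fintype.card_fin, nsmul_eq_mul]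
    field_simp
    ring
  simp only [div_pow, Real.sq_sqrt hn'.le, ← Finset.sum_div]
  rw [hcenter, div_le_iff₀ hn']
  have : 0 ≤ (∑ j, x j) ^ 2 / n := by positivity
  linarith

lemma abs_multiplierStat_le {n : ℕ} (hn : 1 ≤ n) (x ξ : Fin n → ℝ) {b : ℝ}
    (hx : ∀ i, |x i| ≤ b) :
    |multiplierStat x ξ| ≤ 2 * b / Real.sqrt n * ∑ i, |ξ i| := by
  have hn' : (0 : ℝ) < n := by exact_mod_cast hn
  have hmean : |(∑ j, x j) / n| ≤ b := by
    rw [abs_div, abs_of_pos hn', div_le_iff₀ hn']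
    calc |∑ j, x j| ≤ ∑ j, |x j| := Finset.abs_sum_le_sum_abs _ _
      _ ≤ ∑ _j : Fin n, b := Finset.sum_le_sum fun j _ => hx j
      _ = b * n := by simp [mul_comm]
  rw [multiplierStat_eq_sum, Finset.mul_sum]
  refine (Finset.abs_sum_le_sum_abs _ _).trans (Finset.sum_le_sum fun i _ => ?_)
  rw [abs_mul, mul_comm, abs_div, abs_of_nonneg (Real.sqrt_nonneg _)]
  gcongr
  have := abs_sub (x i) ((∑ j, x j) / n)
  linarith [hx i]

lemma integral_abs_eval_gaussianMultipliers_le {n : ℕ} (i : Fin n) :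
    ∫ ξ, |ξ i| ∂(gaussianMultipliers n) ≤ 1 := by
  have := integral_abs_gaussian_sum_le (Pi.single i (1 : ℝ)) one_pos (by simp [Pi.single_apply])
  simpa [Pi.single_apply] using this

lemma integrable_abs_eval_gaussianMultipliers {n : ℕ} (i : Fin n) :
    Integrable (fun ξ : Fin n → ℝ => |ξ i|) (gaussianMultipliers n) := by
  simpa using ((memLp_two_mul_eval_gaussianMultipliers 1 i).integrable one_le_two).abs

/-- The value at the left end, the variation over a grid of mesh `h`, and the error of
rounding to the grid: a bound for the supremum of the multiplier process. -/
def chainBound {n : ℕ} (l : Fin n → ℝ → ℝ) (s h : ℝ) (ξ : Fin n → ℝ) : ℝ :=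
  |multiplierStat (fun i => l i s) ξ|
    + ∑ j ∈ Finset.range n,
        |multiplierStat ((fun i => l i (s + (j + 1 : ℕ) * h)) - fun i => l i (s + j * h)) ξ|
    + 2 * h / Real.sqrt n * ∑ i, |ξ i|

lemma abs_multiplierStat_le_chainBound {n : ℕ} (hn : 1 ≤ n) {l : Fin n → ℝ → ℝ}
    (hl : ∀ i, LipschitzWith 1 (l i)) {s h : ℝ} (hh : 0 < h) {t : ℝ}
    (ht : t ∈ Icc s (s + n * h)) (ξ : Fin n → ℝ) :
    |multiplierStat (fun i => l i t) ξ| ≤ chainBound l s h ξ := by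
  set G : ℝ → ℝ := fun u => multiplierStat (fun i => l i u) ξ with hG
  set k := ⌊(t - s) / h⌋₊ with hk
  have hq : 0 ≤ (t - s) / h := div_nonneg (by linarith [ht.1]) hh.le
  have hkn : k ≤ n := by
    refine Nat.floor_le_of_le ?_
    rw [div_le_iff₀ hh]
    linarith [ht.2]
  have hlow : k * h ≤ t - s := (le_div_iff₀ hh).1 (Nat.floor_le hq)
  have hupp : t - s < (k + 1) * h := (div_lt_iff₀ hh).1 (Nat.lt_floor_add_one _)
  have hround : |G t - G (s + k * h)| ≤ 2 * h / Real.sqrt n * ∑ i, |ξ i| := by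
    rw [hG, ← multiplierStat_sub]
    refine abs_multiplierStat_le hn _ ξ fun i => ?_
    have := (hl i).dist_le_mul t (s + k * h)
    rw [Real.dist_eq, Real.dist_eq, NNReal.coe_one, one_mul] at this
    refine this.trans (abs_le.2 ⟨?_, ?_⟩) <;> linarith
  have hchain : |G (s + k * h) - G s| ≤ ∑ j ∈ Finset.range n,
      |multiplierStat ((fun i => l i (s + (j + 1 : ℕ) * h)) - fun i => l i (s + j * h)) ξ| := by
    have htel := Finset.sum_range_sub (fun j : ℕ => G (s + j * h)) k
    simp only [Nat.cast_zero, zero_mul, add_zero] at htel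
    rw [← htel]
    refine (Finset.abs_sum_le_sum_abs _ _).trans ?_
    simp only [multiplierStat_sub]
    exact Finset.sum_le_sum_of_subset_of_nonneg (Finset.range_mono hkn)
      fun _ _ _ => abs_nonneg _
  have htri : |G t| ≤ |G s| + |G (s + k * h) - G s| + |G t - G (s + k * h)| := by
    have h₁ := abs_add_le (G s) (G (s + k * h) - G s)
    have h₂ := abs_add_le (G (s + k * h)) (G t - G (s + k * h))
    rw [add_sub_cancel] at h₁ h₂
    linarith
  exact htri.trans (add_le_add (add_le_add le_rfl hchain) hround)

lemma integrable_chainBound {n : ℕ} (l : Fin n → ℝ → ℝ) (s h : ℝ) :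
    Integrable (chainBound l s h) (gaussianMultipliers n) :=
  ((integrable_abs_multiplierStat _).add
    (integrable_finsetSum _ fun _ _ => integrable_abs_multiplierStat _)).add
    ((integrable_finsetSum _ fun i _ => integrable_abs_eval_gaussianMultipliers i).const_mul _)

lemma integral_chainBound_le {n : ℕ} (hn : 1 ≤ n) {l : Fin n → ℝ → ℝ}
    (hl : ∀ i, LipschitzWith 1 (l i)) {s h b : ℝ} (hh : 0 < h) (hb : 0 < b)
    (hs : ∀ i, |l i s| ≤ b) :
    ∫ ξ, chainBound l s h ξ ∂(gaussianMultipliers n) ≤ b + 3 * (n * h) := by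
  have hn' : (1 : ℝ) ≤ n := by exact_mod_cast hn
  have hint₁ := integrable_abs_multiplierStat (fun i => l i s)
  have hint₂ : ∀ j ∈ Finset.range n, Integrable (fun ξ => |multiplierStat
      ((fun i => l i (s + (j + 1 : ℕ) * h)) - fun i => l i (s + j * h)) ξ|)
      (gaussianMultipliers n) := fun j _ => integrable_abs_multiplierStat _
  have hint₃ : ∀ i ∈ (Finset.univ : Finset (Fin n)),
      Integrable (fun ξ : Fin n → ℝ => |ξ i|) (gaussianMultipliers n) :=
    fun i _ => integrable_abs_eval_gaussianMultipliers i
  unfold chainBound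
  rw [integral_add (by exact hint₁.add (integrable_finsetSum _ hint₂))
      ((integrable_finsetSum _ hint₃).const_mul _),
    integral_add hint₁ (integrable_finsetSum _ hint₂), integral_const_mul,
    integral_finsetSum _ hint₂, integral_finsetSum _ hint₃]
  have hvar : ∑ j ∈ Finset.range n, ∫ ξ, |multiplierStat
      ((fun i => l i (s + (j + 1 : ℕ) * h)) - fun i => l i (s + j * h)) ξ|
      ∂(gaussianMultipliers n) ≤ n * h := by
    have := Finset.sum_le_card_nsmul (Finset.range n) (fun j : ℕ => ∫ ξ, |multiplierStat
      ((fun i => l i (s + (j + 1 : ℕ) * h)) - fun i => l i (s + j * h)) ξ|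
      ∂(gaussianMultipliers n)) h fun j _ =>
        integral_abs_multiplierStat_le hn _ hh fun i => ?_
    · simpa using this
    · have hd := (hl i).dist_le_mul (s + (j + 1 : ℕ) * h) (s + j * h)
      rw [Real.dist_eq, Real.dist_eq, NNReal.coe_one, one_mul] at hd
      refine hd.trans_eq ?_
      rw [show s + ((j + 1 : ℕ) : ℝ) * h - (s + j * h) = h by push_cast; ring, abs_of_pos hh]
  have hround : 2 * h / Real.sqrt n * ∑ i : Fin n, ∫ ξ, |ξ i| ∂(gaussianMultipliers n)
      ≤ 2 * h * n := by
    have hsum : ∑ i : Fin n, ∫ ξ, |ξ i| ∂(gaussianMultipliers n) ≤ n := by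
      simpa using Finset.sum_le_sum (s := Finset.univ) fun (i : Fin n) _ =>
        integral_abs_eval_gaussianMultipliers_le i
    have hsqrt : 2 * h / Real.sqrt n ≤ 2 * h :=
      div_le_self (by positivity) (Real.one_le_sqrt.2 hn')
    exact mul_le_mul hsqrt hsum
      (Finset.sum_nonneg fun i _ => integral_nonneg fun ξ => abs_nonneg _) (by positivity)
  have := integral_abs_multiplierStat_le hn _ hb hs
  linarith

/-- For landscape-type samples the bootstrap quantile obeys a deterministic bound that does not
depend on the sample size. -/
lemma bootQuant_le {T t₁ t₂ α : ℝ} (hT : 0 < T) (h₁₂ : t₁ < t₂) (hα0 : 0 < α) (hα1 : α < 1)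
    {n : ℕ} (hn : 1 ≤ n) {l : Fin n → C(ℝ, ℝ)} (hl : ∀ i, IsLandscapeType T (l i)) :
    bootQuant t₁ t₂ α n l ≤ (T / 2 + 3 * (t₂ - t₁)) / α := by
  have hn' : (0 : ℝ) < n := by exact_mod_cast hn
  have : Nonempty (Icc t₁ t₂) := ⟨⟨t₁, left_mem_Icc.2 h₁₂.le⟩⟩
  set h := (t₂ - t₁) / n with hh
  have hpos : 0 < h := div_pos (sub_pos.2 h₁₂) hn'
  have hnh : n * h = t₂ - t₁ := by rw [hh]; field_simp
  have hlip : ∀ i, LipschitzWith 1 (l i : ℝ → ℝ) := fun i => (hl i).1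
  have hB : 0 < T / 2 + 3 * (t₂ - t₁) := by linarith
  refine csInf_le ⟨0, fun z hz => ?_⟩ ?_
  · by_contra! hneg
    have huniv : {ξ : Fin n → ℝ | z < ⨆ t : Icc t₁ t₂,
        |(∑ i, ξ i * (l i ↑t - empMean n l ↑t)) / Real.sqrt n|} = univ :=
      eq_univ_of_forall fun ξ => hneg.trans_le (Real.iSup_nonneg fun _ => abs_nonneg _)
    rw [mem_ofPred_eq, huniv, measure_univ, ENNReal.one_le_ofReal] at hz
    linarith
  · have hsub : {ξ : Fin n → ℝ | (T / 2 + 3 * (t₂ - t₁)) / α < ⨆ t : Icc t₁ t₂,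
        |(∑ i, ξ i * (l i ↑t - empMean n l ↑t)) / Real.sqrt n|} ⊆
        {ξ | (T / 2 + 3 * (t₂ - t₁)) / α ≤ chainBound (fun i => l i) t₁ h ξ} := fun ξ hξ =>
      hξ.le.trans (ciSup_le fun t => abs_multiplierStat_le_chainBound hn hlip hpos
        (by rw [hnh, add_sub_cancel]; exact t.2) ξ)
    refine (measure_mono hsub).trans ?_
    have hmarkov := mul_meas_ge_le_integral_of_nonneg (μ := gaussianMultipliers n)
      (f := chainBound (fun i => l i) t₁ h)
      (Eventually.of_forall fun ξ => (abs_nonneg _).trans (abs_multiplierStat_le_chainBound hn hlip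
        hpos (left_mem_Icc.2 (by rw [hnh]; linarith)) ξ))
      (integrable_chainBound _ _ _) ((T / 2 + 3 * (t₂ - t₁)) / α)
    have hmean := integral_chainBound_le hn hlip (s := t₁) hpos (half_pos hT) fun i => by
      rw [abs_of_nonneg ((hl i).2.1 t₁).1]
      exact ((hl i).2.1 t₁).2
    rw [hnh] at hmean
    have hfin := hmarkov.trans hmean
    rw [div_mul_eq_mul_div, div_le_iff₀ hα0] at hfin
    rw [ENNReal.le_ofReal_iff_toReal_le (measure_ne_top _ _) hα0.le]
    exact le_of_mul_le_mul_left hfin hB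

/-- **Uniform confidence band: width.**  If `P` is concentrated on landscape-type
functions and `σ(t) ≥ c > 0` on `[t₁,t₂] ⊆ [0,T]`, then for every `α ∈ (0,1)` and every
`δ ∈ (0,1)` there are `M > 0` and `N₀` such that for all `n ≥ N₀`,
`Pⁿ(Z̃_α(λ_1,…,λ_n) > M) ≤ δ`; equivalently, the width
`sup_t (u_n(t) − ℓ_n(t)) = 2 Z̃_α/√n` of the bootstrap band is `O_P(n^{−1/2})`. -/
theorem uniform_band_width (T : ℝ) (hT : 0 < T)
    (P : Measure C(ℝ, ℝ)) [IsProbabilityMeasure P]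
    (hP : P {f | IsLandscapeType T f} = 1)
    (t₁ t₂ c : ℝ) (ht₁ : 0 ≤ t₁) (h₁₂ : t₁ < t₂) (ht₂ : t₂ ≤ T) (hc : 0 < c)
    (hσ : ∀ t ∈ Icc t₁ t₂, c ≤ lsd P t)
    (α δ : ℝ) (hα0 : 0 < α) (hα1 : α < 1) (hδ0 : 0 < δ) (hδ1 : δ < 1) :
    ∃ M > (0 : ℝ), ∃ N₀ : ℕ, ∀ n ≥ N₀,
      (Measure.pi fun _ : Fin n => P) {l | M < bootQuant t₁ t₂ α n l}
        ≤ ENNReal.ofReal δ := by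
  refine ⟨(T / 2 + 3 * (t₂ - t₁)) / α, div_pos (by linarith) hα0, 1, fun n hn => ?_⟩
  have hae : ∀ᵐ f : C(ℝ, ℝ) ∂P, IsLandscapeType T f :=
    (mem_ae_iff_prob_eq_one (isClosed_isLandscapeType T).measurableSet).2 hP
  have hall : ∀ᵐ l ∂(Measure.pi fun _ : Fin n => P), ∀ i, IsLandscapeType T (l i) :=
    ae_all_iff.2 fun i =>
      (measurePreserving_eval (fun _ : Fin n => P) i).quasiMeasurePreserving.ae hae
  have hzero : (Measure.pi fun _ : Fin n => P)
      {l | (T / 2 + 3 * (t₂ - t₁)) / α < bootQuant t₁ t₂ α n l} = 0 := by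
    refine measure_eq_zero_iff_ae_notMem.2 ?_
    filter_upwards [hall] with l hl
    exact (bootQuant_le hT h₁₂ hα0 hα1 hn hl).not_gt
  rw [hzero]
  exact zero_le
end
end
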